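/- arXiv:1309.2682 — 10 statements merged into one kernel-verified Lean document; each statement's English description precedes it below -/
import Mathlib

section
/- For each integer n ≥ 2203, the system T of equations in the variables x_1,...,x_{n+11} consisting of: x_i · x_i = x_{i+1} for all i ∈ {1,...,n}; x_{n+2} + x_{n+2} = x_{n+3}; x_{n+3} + x_{n+3} = x_{n+4}; x_{n+4} + x_{n+2} = x_{n+5}; x_{n+6} = 1; x_{n+5} + x_{n+6} = x_{n+7}; x_{n+7} + x_{n+6} = x_{n+8}; x_{n+8} + x_{n+6} = x_1; x_{n+8} · x_{n+8} = x_{n+9}; x_{n+9} · x_{n+10} = x_{n+11}; x_{n+11} + x_1 = x_{2204}, has a unique solution (a_1,...,a_{n+11}) in integers; moreover, all the numbers a_1,...,a_{n+11} are positive and max(a_1,...,a_{n+11}) > 2^(2^(n+11)). -/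
/-- The system `T` from Theorem 1, in variables `x 1, ..., x (n+11)` over ℤ. -/
def SolvesT (n : ℕ) (x : ℕ → ℤ) : Prop :=
  (∀ i, 1 ≤ i → i ≤ n → x i * x i = x (i + 1)) ∧
  x (n + 2) + x (n + 2) = x (n + 3) ∧
  x (n + 3) + x (n + 3) = x (n + 4) ∧
  x (n + 4) + x (n + 2) = x (n + 5) ∧
  x (n + 6) = 1 ∧
  x (n + 5) + x (n + 6) = x (n + 7) ∧
  x (n + 7) + x (n + 6) = x (n + 8) ∧
  x (n + 8) + x (n + 6) = x 1 ∧
  x (n + 8) * x (n + 8) = x (n + 9) ∧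
  x (n + 9) * x (n + 10) = x (n + 11) ∧
  x (n + 11) + x 1 = x 2204

open LucasLehmer LucasLehmer.norm_num_ext

/-- Splitting a run of the Lucas-Lehmer iteration. -/
lemma aux_split {q b c i j r : ℕ} (h : sModNatAux b q i = c) (h' : sModNatAux c q j = r) :
    sModNatAux b q (i + j) = r := by
  induction j generalizing r with
  | zero => simpa [sModNatAux, h] using h'
  | succ j ih => rw [← add_assoc, sModNatAux, ih rfl, ← h', sModNatAux]

lemma ll_0 : sModNatAux
    4
    (2 ^ 2203 - 1) 100 =
    411475438465844926048578772961639097045114578055482940322202643219285933873277378791193648803169090827833559221159183279991125709764077455085581684262254578279599524869200658799634545930125723916126476487348569317884992936276452873845799353674744225267692153720018678045375510355142697359594156928224227021314332758171243649673412795476022206399867481070475082165087190006607682616228981022164753042131990499755178720649080377836101537376593919344401937437961442824147222371239643676612119577705373675328626670094155893033530981218247127461518571192658408276725961999543078236986460562353680179928511011515210049320425785729675808721918024049094541850954824449911 := by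
  decide +kernel

lemma ll_1 : sModNatAux
    411475438465844926048578772961639097045114578055482940322202643219285933873277378791193648803169090827833559221159183279991125709764077455085581684262254578279599524869200658799634545930125723916126476487348569317884992936276452873845799353674744225267692153720018678045375510355142697359594156928224227021314332758171243649673412795476022206399867481070475082165087190006607682616228981022164753042131990499755178720649080377836101537376593919344401937437961442824147222371239643676612119577705373675328626670094155893033530981218247127461518571192658408276725961999543078236986460562353680179928511011515210049320425785729675808721918024049094541850954824449911
    (2 ^ 2203 - 1) 100 =
    169547908576752503483437252313065824318557769668941464166475146758870050016042081167663577174860190510238814713199643006391057268958394784305399454490150544568045147897066861266745520491045430957399652244461494394125784488372526847183761745538152026027654897322914233334764682411403581606902079406446089030669743943070473988298514481625253485859679034487927601990033799237140697406698848258027545186117794068751585188857119672803504031395334183433868839720221061169537247896183858677346137556617033240328964384044187494998885062898380202238982040594974276845111433630378743391239289329416307393869061222550896277890660968215861893878796792121386722613942451914901 := by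
  decide +kernel

lemma ll_2 : sModNatAux
    169547908576752503483437252313065824318557769668941464166475146758870050016042081167663577174860190510238814713199643006391057268958394784305399454490150544568045147897066861266745520491045430957399652244461494394125784488372526847183761745538152026027654897322914233334764682411403581606902079406446089030669743943070473988298514481625253485859679034487927601990033799237140697406698848258027545186117794068751585188857119672803504031395334183433868839720221061169537247896183858677346137556617033240328964384044187494998885062898380202238982040594974276845111433630378743391239289329416307393869061222550896277890660968215861893878796792121386722613942451914901
    (2 ^ 2203 - 1) 100 =
    1452470217123907677171435151019311438299534210089678525013300236230605603169395615085997860059337634003643051056197204792847039052636211025238922188539762435144353108155207919214678772373982687343217979178336479281397190691279273122412323747363505576466202035751871289486483931395261667930553281971013370032147550554320819023113771184028839111517558503575090317498602142649017338248964286597714721720468041615777852769093518563702661778962742209094414704415100349737006657349477777805421061693077785144869364498737304655078048227119366563838254302397240531096487358107010962454458016017642441210577456543663413081385260089674820863076871419355566226403671482591673 := by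
  decide +kernel

lemma ll_3 : sModNatAux
    1452470217123907677171435151019311438299534210089678525013300236230605603169395615085997860059337634003643051056197204792847039052636211025238922188539762435144353108155207919214678772373982687343217979178336479281397190691279273122412323747363505576466202035751871289486483931395261667930553281971013370032147550554320819023113771184028839111517558503575090317498602142649017338248964286597714721720468041615777852769093518563702661778962742209094414704415100349737006657349477777805421061693077785144869364498737304655078048227119366563838254302397240531096487358107010962454458016017642441210577456543663413081385260089674820863076871419355566226403671482591673
    (2 ^ 2203 - 1) 100 =
    624340694097169744512189664912030415354062517359127754112856348462449824244095883087520573136118751237483312479408299782343264901656449531608407929785185377372567289451097558315243095030106542935797214884998493507539999059781768632323491259349484474333432626613949418403513313283457452314603024801137648578196387453327298670366250066507830650705712126067606335828920262675815379567739921502827370258094372328081259658147108306432762995097753648932767291296340940740695782899018774268280668097299499335187309952424694357079883484739880049377810530664234170197560429733118124375607852068106090347310478445913084289871997699274725596185041454723987192150801313351864 := by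
  decide +kernel

lemma ll_4 : sModNatAux
    624340694097169744512189664912030415354062517359127754112856348462449824244095883087520573136118751237483312479408299782343264901656449531608407929785185377372567289451097558315243095030106542935797214884998493507539999059781768632323491259349484474333432626613949418403513313283457452314603024801137648578196387453327298670366250066507830650705712126067606335828920262675815379567739921502827370258094372328081259658147108306432762995097753648932767291296340940740695782899018774268280668097299499335187309952424694357079883484739880049377810530664234170197560429733118124375607852068106090347310478445913084289871997699274725596185041454723987192150801313351864
    (2 ^ 2203 - 1) 100 =
    527643258992142484419651858975609020048013601498543345360908827700043553835935127604829105675135318673214653165186200134749280596008579297895769048489550068936173902087757481842064920038947475795731184359715170299398609545630234352038951464233060851896438182798110241656524968169466874192189253173739560193700238187394187915849474883431507159358242180799677745215579637922871709886240060641004937394937074982990523576762006603399774644564742895197081908276893429679561183807022787075886617947527967366874066411396264800709596303138197831089919891304387649278637756848963017758080230293194870394838233767346711855174910434079160821110441565509767015811892453004685 := by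
  decide +kernel

lemma ll_5 : sModNatAux
    527643258992142484419651858975609020048013601498543345360908827700043553835935127604829105675135318673214653165186200134749280596008579297895769048489550068936173902087757481842064920038947475795731184359715170299398609545630234352038951464233060851896438182798110241656524968169466874192189253173739560193700238187394187915849474883431507159358242180799677745215579637922871709886240060641004937394937074982990523576762006603399774644564742895197081908276893429679561183807022787075886617947527967366874066411396264800709596303138197831089919891304387649278637756848963017758080230293194870394838233767346711855174910434079160821110441565509767015811892453004685
    (2 ^ 2203 - 1) 100 =
    1281139386081893586754686431758842442946198270348849414902851820306497160155531310060780679586954728326208496981023197966998013771519160625038976110284482644287024224286970163808215620301753623315686291931807197827795356733933633358750215595833760243806499305514261092199302067407301987901776944728939860459494148219463189610799844551524723822767940591463897036568260640739865038397707826522397316365310103173426354685091965513171715141634946400001969588186205212117917902809293350954160239780311033803282985336101911661707573238082726712367519565149121237536648568396446093492253198008927823233782265600681112446058116218759259929193984511225126229921637709162242 := by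
  decide +kernel

lemma ll_6 : sModNatAux
    1281139386081893586754686431758842442946198270348849414902851820306497160155531310060780679586954728326208496981023197966998013771519160625038976110284482644287024224286970163808215620301753623315686291931807197827795356733933633358750215595833760243806499305514261092199302067407301987901776944728939860459494148219463189610799844551524723822767940591463897036568260640739865038397707826522397316365310103173426354685091965513171715141634946400001969588186205212117917902809293350954160239780311033803282985336101911661707573238082726712367519565149121237536648568396446093492253198008927823233782265600681112446058116218759259929193984511225126229921637709162242
    (2 ^ 2203 - 1) 100 =
    1391144337883942172146473605079939083875807811823501672360563256722149918717377095925063536636310022923377947421623959547793885132542006891450095434084684578016897678339247436012317161350542794160567798178220103342049269496488190596608303627839557312971520600061882177078461945301144742010095870436312149908207083167262033924599520514699396540453802422780595437351682708926699849945567472287216121526614885673398013465534881374584030922690009263485748223940161666594552730531646491603411473464917415773435582894979438881082792447467660577112680464634548288354403655980424979825542498359954137642073459627824653319861001916980701711869911709761721396395254922700819 := by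
  decide +kernel

lemma ll_7 : sModNatAux
    1391144337883942172146473605079939083875807811823501672360563256722149918717377095925063536636310022923377947421623959547793885132542006891450095434084684578016897678339247436012317161350542794160567798178220103342049269496488190596608303627839557312971520600061882177078461945301144742010095870436312149908207083167262033924599520514699396540453802422780595437351682708926699849945567472287216121526614885673398013465534881374584030922690009263485748223940161666594552730531646491603411473464917415773435582894979438881082792447467660577112680464634548288354403655980424979825542498359954137642073459627824653319861001916980701711869911709761721396395254922700819
    (2 ^ 2203 - 1) 100 =
    303448708603112041409438006779389686693388914509604260264507132368221454393712582516838489379758528627735451032094633793913626875801899723889103895058111651566605242820121343846071230768673366858202948151059942900636936836385845824260832343232121276312446337936707906814778239100014174375560144972510979664108444677863503572673663011707162520675109991894833215855522920102195766535468560325806488981679688530097504770372370838391447425497012425006822358440737281418155594164410772239502502109364672524527577026443160679540738389094338175048394524225524287792291068538342701043279950868492112454158855653435242993333798979570739371659899952114329476014079187220211 := by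
  decide +kernel

lemma ll_8 : sModNatAux
    303448708603112041409438006779389686693388914509604260264507132368221454393712582516838489379758528627735451032094633793913626875801899723889103895058111651566605242820121343846071230768673366858202948151059942900636936836385845824260832343232121276312446337936707906814778239100014174375560144972510979664108444677863503572673663011707162520675109991894833215855522920102195766535468560325806488981679688530097504770372370838391447425497012425006822358440737281418155594164410772239502502109364672524527577026443160679540738389094338175048394524225524287792291068538342701043279950868492112454158855653435242993333798979570739371659899952114329476014079187220211
    (2 ^ 2203 - 1) 100 =
    1139383330412104028375713867298889770911375139253368273127642063144389440112810261130326257755726560048324506370762025214879320704478855988997088572316135665311157951228914562239549975142296432028829413351763319358049273916541586912511957145785865093865375914779241762560535465042833098983196689959662197432147889552041698851669797839766215988916235038558963487894743138021294126275171467188558539973252381111254403342117977419704478877281246322256983125980061064607870381176632006335200903802881997648630629091151941490741457056703470598164245664947488080193162857567341982978883171411550167640091134734230742987819954680216352519625331014158175166093110835491346 := by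
  decide +kernel

lemma ll_9 : sModNatAux
    1139383330412104028375713867298889770911375139253368273127642063144389440112810261130326257755726560048324506370762025214879320704478855988997088572316135665311157951228914562239549975142296432028829413351763319358049273916541586912511957145785865093865375914779241762560535465042833098983196689959662197432147889552041698851669797839766215988916235038558963487894743138021294126275171467188558539973252381111254403342117977419704478877281246322256983125980061064607870381176632006335200903802881997648630629091151941490741457056703470598164245664947488080193162857567341982978883171411550167640091134734230742987819954680216352519625331014158175166093110835491346
    (2 ^ 2203 - 1) 100 =
    59874563788407277161552335727704683477541918190133824765483062579331977474084852898403324118156219394383129088650385961492605756248745163051528908032840516897492231130922376951323019440534905580388656066806168595151616565049100851803621020595862914393280884676507351244722152494167958308214325801579673594706892507238462663565872203925965607510704399686496292354387506938664533943586080140050474377525225968750323352720622451516220078890132741832976588236160898108016184905027503095365519707097297909518085304627639038296947881957253303320209672633069111299917500804541901407097705497460935415395749005435001763936299511838628015272931676567033469070983995787279 := by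
  decide +kernel

lemma ll_10 : sModNatAux
    59874563788407277161552335727704683477541918190133824765483062579331977474084852898403324118156219394383129088650385961492605756248745163051528908032840516897492231130922376951323019440534905580388656066806168595151616565049100851803621020595862914393280884676507351244722152494167958308214325801579673594706892507238462663565872203925965607510704399686496292354387506938664533943586080140050474377525225968750323352720622451516220078890132741832976588236160898108016184905027503095365519707097297909518085304627639038296947881957253303320209672633069111299917500804541901407097705497460935415395749005435001763936299511838628015272931676567033469070983995787279
    (2 ^ 2203 - 1) 100 =
    178934535309923642741268243816725231585936817696827995117407586331794870388736692980775294888679233423618367779190051144535410556462210020485965438499019639370290603702629449273426753699123109906404217129365964621433511307110021567132231233005845529286217874952183749462808893752585080459255620520320019984032710949189741558723289934864374522001260326676384440743727233931588790741218678467958891922255208190832534227595822898636655196685964258659733052828878697712700679221913562353010159132213105528798460900710394462405609480477286370383524099954225863372365280281998053851341756535846183275429036768274588146969794647217386459856208607780451020148772266406495 := by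
  decide +kernel

lemma ll_11 : sModNatAux
    178934535309923642741268243816725231585936817696827995117407586331794870388736692980775294888679233423618367779190051144535410556462210020485965438499019639370290603702629449273426753699123109906404217129365964621433511307110021567132231233005845529286217874952183749462808893752585080459255620520320019984032710949189741558723289934864374522001260326676384440743727233931588790741218678467958891922255208190832534227595822898636655196685964258659733052828878697712700679221913562353010159132213105528798460900710394462405609480477286370383524099954225863372365280281998053851341756535846183275429036768274588146969794647217386459856208607780451020148772266406495
    (2 ^ 2203 - 1) 100 =
    547326354822398902204694255473453289261690026551467009130988020568931733966321343838776828076620485655122077603193465110996272989042046944672667650732347681268148652647097089121214198852933767814250909893797148332471709110612163663196534671571333044173777941955715961805957421565065863597474093229617129692093089999492657934205867936064110183946206264732657517578980925406647389962283881691930563738038419418816278700619932609621208271561392482458374771784336834458742776661376275202206949538931777609308763414628647734606813241600077213539677213174631150075450226290666503712284620484454876883340461212732659146853867049565256663248851258533092492693687874350461 := by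
  decide +kernel

lemma ll_12 : sModNatAux
    547326354822398902204694255473453289261690026551467009130988020568931733966321343838776828076620485655122077603193465110996272989042046944672667650732347681268148652647097089121214198852933767814250909893797148332471709110612163663196534671571333044173777941955715961805957421565065863597474093229617129692093089999492657934205867936064110183946206264732657517578980925406647389962283881691930563738038419418816278700619932609621208271561392482458374771784336834458742776661376275202206949538931777609308763414628647734606813241600077213539677213174631150075450226290666503712284620484454876883340461212732659146853867049565256663248851258533092492693687874350461
    (2 ^ 2203 - 1) 100 =
    819628887248324533731459618156701095178429100309031341921933807814903856605557485153116155246953365741460704787274999182693635934047649802994031788621432091893533466898121421244334848372236963242517244867351725605499392852217184281409452272232215603960194209113587256987721461080505897928098251242763641478508629153775477776242974237659979439688020948603077801287901879630533209830823747130705777998165264117968760732626027369011083327492344917819007683348392968793939947255833226790440264315018360579308953830476850738249727022812194755944638779419805079947329202824845991885847528998092394756972803976555754666277616830210169178546477565360639817899987178212763 := by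
  decide +kernel

lemma ll_13 : sModNatAux
    819628887248324533731459618156701095178429100309031341921933807814903856605557485153116155246953365741460704787274999182693635934047649802994031788621432091893533466898121421244334848372236963242517244867351725605499392852217184281409452272232215603960194209113587256987721461080505897928098251242763641478508629153775477776242974237659979439688020948603077801287901879630533209830823747130705777998165264117968760732626027369011083327492344917819007683348392968793939947255833226790440264315018360579308953830476850738249727022812194755944638779419805079947329202824845991885847528998092394756972803976555754666277616830210169178546477565360639817899987178212763
    (2 ^ 2203 - 1) 100 =
    306868235003975741384689634255250727516254809831503343918205588331550038011183610228373332810401240653803167235162942465949754243297437891776945973995702036937188225663698457752006670314448889377389387276676948629972244400625477473906328156140167316926984743673215621015802699156242306259185161749928246370204987434679013761919196807557185806802346183213250607532116615731282825868157980039225232076877052931791555293184989312906444569292725909676280385875175566885161261792677167985100749719191742913623427437286077623061800783370851301892504026584587966794132916573752111110297197585337772259305043005821142709227235755919014526949197412972650200018575346267423 := by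
  decide +kernel

lemma ll_14 : sModNatAux
    306868235003975741384689634255250727516254809831503343918205588331550038011183610228373332810401240653803167235162942465949754243297437891776945973995702036937188225663698457752006670314448889377389387276676948629972244400625477473906328156140167316926984743673215621015802699156242306259185161749928246370204987434679013761919196807557185806802346183213250607532116615731282825868157980039225232076877052931791555293184989312906444569292725909676280385875175566885161261792677167985100749719191742913623427437286077623061800783370851301892504026584587966794132916573752111110297197585337772259305043005821142709227235755919014526949197412972650200018575346267423
    (2 ^ 2203 - 1) 100 =
    492360092769642420436285888827499079845658885145030030843269956569488321410875677203525798606684666574910585603829526806642271531117572556909978742578172143938413776528308778837506781154911574628253343846823499081680732019236140928045070044429635327585180799456211956051927550286967991219102505414424374010376575678380876478231888690997298537152253119064811558076704934651743147976207191898246050865724018608244213380260446628253135623128585072665761447791617912343570140412182647785976175187064407691945966075333879639045595770664481516741038336471554654866141366078212430401619241892792363463056825637805245670475401582835473239143851801527021118716377176896626 := by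
  decide +kernel

lemma ll_15 : sModNatAux
    492360092769642420436285888827499079845658885145030030843269956569488321410875677203525798606684666574910585603829526806642271531117572556909978742578172143938413776528308778837506781154911574628253343846823499081680732019236140928045070044429635327585180799456211956051927550286967991219102505414424374010376575678380876478231888690997298537152253119064811558076704934651743147976207191898246050865724018608244213380260446628253135623128585072665761447791617912343570140412182647785976175187064407691945966075333879639045595770664481516741038336471554654866141366078212430401619241892792363463056825637805245670475401582835473239143851801527021118716377176896626
    (2 ^ 2203 - 1) 100 =
    1245946563333424951505388922867439297324604079258922827890174838255442967769886102026814566000826895702315294930804224820076236110318813840310353685268423653071050574700071224494294713461256485156944053421485766379917448525649573405981597459109429029065775950942361237167853826689243720000513054396940387297642844252850177720370140917223537944558994875657348102738491405749166822111546033492286851066162036529466464798781571466042919518254388420202450195682019179545269441885943408677302839129635911494634187514180527125794182201625472885701625087251036960322169654792124131095267518931575733451766892899628719441032676035459139686574314287854174571755763767994648 := by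
  decide +kernel

lemma ll_16 : sModNatAux
    1245946563333424951505388922867439297324604079258922827890174838255442967769886102026814566000826895702315294930804224820076236110318813840310353685268423653071050574700071224494294713461256485156944053421485766379917448525649573405981597459109429029065775950942361237167853826689243720000513054396940387297642844252850177720370140917223537944558994875657348102738491405749166822111546033492286851066162036529466464798781571466042919518254388420202450195682019179545269441885943408677302839129635911494634187514180527125794182201625472885701625087251036960322169654792124131095267518931575733451766892899628719441032676035459139686574314287854174571755763767994648
    (2 ^ 2203 - 1) 100 =
    1208377112502652498444990935426535957590090211386260332538666702569662550997784435731653944677914636810028999959703163844795624932750541984347940912239505943031585715446008126109378909079879329658972258746317734160395984033839198667656140415086379267577790405286742424727950171219001056559065647631299573889821205137988344795156020798888093798067690583637095978451927707726351988707651684170550648106648729330844318064295867404946843770206620621629912783500268457533372953454959536623884891030747029385543930972113194334449530235193868166588928153348636279991506078358707077584586568118288585427145850040671749163310149530231907824263079073171884441253118506490727 := by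
  decide +kernel

lemma ll_17 : sModNatAux
    1208377112502652498444990935426535957590090211386260332538666702569662550997784435731653944677914636810028999959703163844795624932750541984347940912239505943031585715446008126109378909079879329658972258746317734160395984033839198667656140415086379267577790405286742424727950171219001056559065647631299573889821205137988344795156020798888093798067690583637095978451927707726351988707651684170550648106648729330844318064295867404946843770206620621629912783500268457533372953454959536623884891030747029385543930972113194334449530235193868166588928153348636279991506078358707077584586568118288585427145850040671749163310149530231907824263079073171884441253118506490727
    (2 ^ 2203 - 1) 100 =
    1390742006562358735077070062805650876479087854694122059849697406247741409714205854129662777929716754508006861234817949696069982115878830771246297392877442223933098931735044062784258516369685687151221078794023560222805912401266812618380951026441629736048470012671912490519469834276505278779282637567247368419843563795958557096866449196227365229059328908425551974686417651997100285322907145952002323741868959058656062757616182543494933447547860768309822951605191713427036264589732580771608711079238574622901562302618394738319034683550227555674036822135612463457151688923376952804147125560124307172304621777102211628027614698343515614331161486965913968425796430774200 := by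
  decide +kernel

lemma ll_18 : sModNatAux
    1390742006562358735077070062805650876479087854694122059849697406247741409714205854129662777929716754508006861234817949696069982115878830771246297392877442223933098931735044062784258516369685687151221078794023560222805912401266812618380951026441629736048470012671912490519469834276505278779282637567247368419843563795958557096866449196227365229059328908425551974686417651997100285322907145952002323741868959058656062757616182543494933447547860768309822951605191713427036264589732580771608711079238574622901562302618394738319034683550227555674036822135612463457151688923376952804147125560124307172304621777102211628027614698343515614331161486965913968425796430774200
    (2 ^ 2203 - 1) 100 =
    474547773826428029697299983031959371303199671792227586084181475905299172174237937992639875716662972139225332006133346350134178069034220112249904191437449754329374159667200227104694312282540470785167590243000543131975257455560169364463121736560263479826040268651098827340501277310285490027779545672464206494503800440894490574873522110642451602211591161079026632285119882648218686202474152511256079004379005378271746685649672821864902607439400757671436977028551554638624661323905093368223505535545394588516986689360374863261007920565386951219239128947098309410807168265531539243632790760472694379059961341013297896005079882333173805593301719094413734263436985424930 := by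
  decide +kernel

lemma ll_19 : sModNatAux
    474547773826428029697299983031959371303199671792227586084181475905299172174237937992639875716662972139225332006133346350134178069034220112249904191437449754329374159667200227104694312282540470785167590243000543131975257455560169364463121736560263479826040268651098827340501277310285490027779545672464206494503800440894490574873522110642451602211591161079026632285119882648218686202474152511256079004379005378271746685649672821864902607439400757671436977028551554638624661323905093368223505535545394588516986689360374863261007920565386951219239128947098309410807168265531539243632790760472694379059961341013297896005079882333173805593301719094413734263436985424930
    (2 ^ 2203 - 1) 100 =
    1269706574391055837457392306783886876306540853544878054227894636348764234690780747288223705182333155683155002339359411276441554413132672842342307285733090030137325244323173277151871716309237304233476664578570594400670843261133528266872393603132521669152498093708737151670272940347059424172928620764045178361083036910828996170038067864033831718684931751835590135871649475621186688108410517322674917468364567561203628637662249065170921267687746361825308976000322263733477718554784789357434186758109805830207747581750358840575170960925289461128405405915095919729431249082564989961889060798705822308405413828223514168723159728988575588613672755083279390267159881729453 := by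
  decide +kernel

lemma ll_20 : sModNatAux
    1269706574391055837457392306783886876306540853544878054227894636348764234690780747288223705182333155683155002339359411276441554413132672842342307285733090030137325244323173277151871716309237304233476664578570594400670843261133528266872393603132521669152498093708737151670272940347059424172928620764045178361083036910828996170038067864033831718684931751835590135871649475621186688108410517322674917468364567561203628637662249065170921267687746361825308976000322263733477718554784789357434186758109805830207747581750358840575170960925289461128405405915095919729431249082564989961889060798705822308405413828223514168723159728988575588613672755083279390267159881729453
    (2 ^ 2203 - 1) 100 =
    1135392213720441765292112154451259875642957807577651576876462154120963142207202777077584969278274654563685452662068969939331795198457183096762895503518173672336205633311427523975857479429070892288686943642041674769038306393818013820857205004144592776313602326048941428653994670855195674365153907787617968139609891658638136779191056090247690523442162720233180729216846865358340131468500734694057618628020913774555450350842306936445465835167329382677229888358902063953715574213771677188494030979965072794605854011445753508854144931233036486547330440100837064385120190999437531317055806976818115784433381432581787687538769692785717092241444879657585303485582672880933 := by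
  decide +kernel

lemma ll_21 : sModNatAux
    1135392213720441765292112154451259875642957807577651576876462154120963142207202777077584969278274654563685452662068969939331795198457183096762895503518173672336205633311427523975857479429070892288686943642041674769038306393818013820857205004144592776313602326048941428653994670855195674365153907787617968139609891658638136779191056090247690523442162720233180729216846865358340131468500734694057618628020913774555450350842306936445465835167329382677229888358902063953715574213771677188494030979965072794605854011445753508854144931233036486547330440100837064385120190999437531317055806976818115784433381432581787687538769692785717092241444879657585303485582672880933
    (2 ^ 2203 - 1) 100 =
    54331941161975433971094057134370671144139753877269781989940786789112523710169673948821568332830242369194313051815389533900154902172939719884622193371202514887543053997625561327131456576658722923067348642104892706051193743088519826213421144128812321523103038929280795940379536016276464492336591501748734633869860595795162210976661504 := by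
  decide +kernel

lemma ll_22 : sModNatAux
    54331941161975433971094057134370671144139753877269781989940786789112523710169673948821568332830242369194313051815389533900154902172939719884622193371202514887543053997625561327131456576658722923067348642104892706051193743088519826213421144128812321523103038929280795940379536016276464492336591501748734633869860595795162210976661504
    (2 ^ 2203 - 1) 1 =
    0 := by
  decide +kernel

lemma ll_test : LucasLehmerTest 2203 := by
  have h :=
    (aux_split (aux_split 
      (aux_split (aux_split (aux_split (aux_split 
      (aux_split (aux_split (aux_split (aux_split 
      (aux_split (aux_split (aux_split (aux_split 
      (aux_split (aux_split (aux_split (aux_split 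
      (aux_split (aux_split (aux_split (aux_split ll_0 ll_1) ll_2) ll_3) ll_4) ll_5) ll_6) ll_7) ll_8) ll_9) ll_10) ll_11) ll_12) ll_13) ll_14) ll_15) ll_16) ll_17) ll_18) ll_19) ll_20) ll_21) ll_22)
  simp only [Nat.reduceAdd] at h
  have h4 : 4 % (2 ^ 2203 - 1) = 4 := by decide +kernel
  rw [LucasLehmerTest, LucasLehmer.residue_eq_zero_iff_sMod_eq_zero 2203 (by norm_num),
    ← sModNat_eq_sMod 2203 _ (by norm_num), ← sModNatAux_eq, h4]
  exact congrArg Nat.cast h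

lemma prime_2203 : Nat.Prime (2 ^ 2203 - 1) :=
  lucas_lehmer_sufficiency 2203 (by norm_num) ll_test

/-- The arithmetic core: `(y - 1) ^ 2 ∣ y ^ (p + 1) - y` forces `y - 1 ∣ p`. -/
lemma dvd_core (p : ℕ) (y s : ℤ) (hy : y ≠ 1) (h : (y - 1) * (y - 1) * s + y = y ^ (p + 1)) :
    (y - 1) ∣ (p : ℤ) := by
  have hg : (∑ i ∈ Finset.range p, y ^ i) * (y - 1) = y ^ p - 1 := geom_sum_mul y p
  have hne : y - 1 ≠ 0 := sub_ne_zero.mpr hy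
  have h1 : (y - 1) * s = y * ∑ i ∈ Finset.range p, y ^ i := by
    apply mul_left_cancel₀ hne
    rw [pow_succ] at h
    linear_combination h - y * hg
  have hm : (∑ i ∈ Finset.range p, y ^ i) ≡ (p : ℤ) [ZMOD (y - 1)] := by
    have hy1 : y ≡ 1 [ZMOD (y - 1)] := (Int.modEq_sub y 1)
    have : (∑ i ∈ Finset.range p, y ^ i) ≡ ∑ i ∈ Finset.range p, (1 : ℤ) [ZMOD (y - 1)] := by
      apply Int.ModEq.sum
      intro i _
      simpa using hy1.pow i
    simpa using this
  have hc : IsCoprime (y - 1) y := ⟨-1, 1, by ring⟩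
  have hd : (y - 1) ∣ ∑ i ∈ Finset.range p, y ^ i := hc.dvd_of_dvd_mul_left ⟨s, h1.symm⟩
  exact (hm.dvd_iff).mp hd

lemma mod_core (p : ℕ) (hp : p.Prime) (h5 : (p : ℤ) % 5 = 2) (t s : ℤ)
    (h : (5 * t + 2) * (5 * t + 2) * s + (5 * t + 3) = (5 * t + 3) ^ (p + 1)) :
    5 * t + 2 = p := by
  have hd : (5 * t + 3 - 1) ∣ (p : ℤ) := by
    refine dvd_core p _ s (by omega) ?_
    rw [← h]; ring
  have h2 : (5 * t + 3 - 1).natAbs ∣ p := Int.natAbs_dvd_natAbs.mpr hd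
  rcases (Nat.dvd_prime hp).mp h2 with h3 | h3 <;> omega

lemma sq_chain (n : ℕ) (x : ℕ → ℤ) (h : ∀ i, 1 ≤ i → i ≤ n → x i * x i = x (i + 1)) :
    ∀ k, k ≤ n → x (k + 1) = x 1 ^ (2 ^ k) := by
  intro k
  induction k with
  | zero => simp
  | succ k ih =>
    intro hk
    rw [← h (k + 1) (by omega) hk, ih (by omega), pow_succ, pow_mul, sq]

/-- The solution, in terms of `p`, `t`, `s`. -/
def sol (p t s : ℤ) (n i : ℕ) : ℤ :=
  if i ≤ n + 1 then (p + 1) ^ (2 ^ (i - 1)) else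
  if i = n + 2 then t else
  if i = n + 3 then 2 * t else
  if i = n + 4 then 4 * t else
  if i = n + 5 then 5 * t else
  if i = n + 6 then 1 else
  if i = n + 7 then 5 * t + 1 else
  if i = n + 8 then p else
  if i = n + 9 then p * p else
  if i = n + 10 then s else p * p * s

/-- Existence of `s`. -/
lemma exists_s (p : ℕ) (hp : 0 < p) :
    ∃ s : ℤ, 0 < s ∧ (p : ℤ) * p * s + (p + 1) = ((p : ℤ) + 1) ^ (p + 1) := by
  have hp' : (0 : ℤ) < p := by exact_mod_cast hp
  have h1 : (p : ℤ) * p ∣ ((p : ℤ) + 1) ^ (p + 1) - (p + 1) := by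
    have hg : (∑ i ∈ Finset.range p, ((p : ℤ) + 1) ^ i) * ((p + 1) - 1) = ((p : ℤ) + 1) ^ p - 1 :=
      geom_sum_mul _ p
    have hm : (∑ i ∈ Finset.range p, ((p : ℤ) + 1) ^ i) ≡
        ∑ i ∈ Finset.range p, (1 : ℤ) [ZMOD (p : ℤ)] := by
      apply Int.ModEq.sum
      intro i _
      have : (p : ℤ) + 1 ≡ 1 [ZMOD (p : ℤ)] := by simp [Int.ModEq]
      simpa using this.pow i
    have hd : (p : ℤ) ∣ ∑ i ∈ Finset.range p, ((p : ℤ) + 1) ^ i :=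
      (hm.dvd_iff).mpr (by simp)
    obtain ⟨c, hc⟩ := hd
    refine ⟨c * (p + 1), ?_⟩
    rw [hc] at hg
    rw [pow_succ]
    linear_combination (-(p : ℤ) - 1) * hg
  obtain ⟨s, hs⟩ := h1
  refine ⟨s, ?_, by linarith⟩
  have hlt : ((p : ℤ) + 1) ^ 1 < ((p : ℤ) + 1) ^ (p + 1) :=
    pow_lt_pow_right₀ (by linarith) (by omega)
  have : 0 < (p : ℤ) * p * s := by rw [← hs]; linarith
  exact pos_of_mul_pos_right this (by positivity)

lemma main_aux (n p : ℕ) (hn : 2203 ≤ n) (hp : p.Prime) (h5 : (p : ℤ) % 5 = 2)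
    (hp2 : 2 < p) (hpe : p + 1 = 2 ^ 2203) :
    ∃ a : ℕ → ℤ, SolvesT n a ∧
      (∀ b : ℕ → ℤ, SolvesT n b → ∀ i, 1 ≤ i → i ≤ n + 11 → b i = a i) ∧
      (∀ i, 1 ≤ i → i ≤ n + 11 → 0 < a i) ∧
      (∃ i, 1 ≤ i ∧ i ≤ n + 11 ∧ (2 : ℤ) ^ (2 ^ (n + 11)) < a i) := by
  obtain ⟨s, hs0, hs⟩ := exists_s p hp.pos
  obtain ⟨t, ht⟩ : ∃ t : ℤ, (p : ℤ) = 5 * t + 2 := ⟨p / 5, by omega⟩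
  have ht0 : 0 < t := by omega
  have hlow : ∀ i, i ≤ n + 1 → sol p t s n i = ((p : ℤ) + 1) ^ (2 ^ (i - 1)) := by
    intro i hi
    simp only [sol, if_pos hi]
  have e2 : sol p t s n (n + 2) = t := by simp [sol]
  have e3 : sol p t s n (n + 3) = 2 * t := by simp [sol]
  have e4 : sol p t s n (n + 4) = 4 * t := by simp [sol]
  have e5 : sol p t s n (n + 5) = 5 * t := by simp [sol]
  have e6 : sol p t s n (n + 6) = 1 := by simp [sol]
  have e7 : sol p t s n (n + 7) = 5 * t + 1 := by simp [sol]
  have e8 : sol p t s n (n + 8) = p := by simp [sol]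
  have e9 : sol p t s n (n + 9) = p * p := by simp [sol]
  have e10 : sol p t s n (n + 10) = s := by simp [sol]
  have e11 : sol p t s n (n + 11) = p * p * s := by simp [sol]
  have e1 : sol p t s n 1 = p + 1 := by
    rw [hlow 1 (by omega)]; simp
  have cases_i : ∀ i, 1 ≤ i → i ≤ n + 11 → (∃ k, k ≤ n ∧ i = k + 1) ∨ i = n + 2 ∨ i = n + 3 ∨
      i = n + 4 ∨ i = n + 5 ∨ i = n + 6 ∨ i = n + 7 ∨ i = n + 8 ∨ i = n + 9 ∨ i = n + 10 ∨
      i = n + 11 := by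
    intro i h1 h2
    by_cases h : i ≤ n + 1
    · exact Or.inl ⟨i - 1, by omega, by omega⟩
    · right; omega
  have hp0 : (0 : ℤ) < p := by exact_mod_cast hp.pos
  refine ⟨sol p t s n, ?_, ?_, ?_, ?_⟩
  · refine ⟨?_, ?_, ?_, ?_, ?_, ?_, ?_, ?_, ?_, ?_, ?_⟩
    · intro i h1 h2
      obtain ⟨k, rfl⟩ : ∃ k, i = k + 1 := ⟨i - 1, by omega⟩
      rw [hlow _ (by omega), hlow _ (by omega), Nat.add_sub_cancel, Nat.add_sub_cancel,
        pow_succ 2 k, pow_mul, sq]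
    · rw [e2, e3]; ring
    · rw [e3, e4]; ring
    · rw [e4, e2, e5]; ring
    · exact e6
    · rw [e5, e6, e7]
    · rw [e7, e6, e8, ht]; ring
    · rw [e8, e6, e1]
    · rw [e8, e9]
    · rw [e9, e10, e11]
    · have h2204 := hlow 2204 (by omega)
      rw [show 2204 - 1 = 2203 from rfl, ← hpe] at h2204
      rw [h2204, e11, e1]
      exact hs
  · rintro b ⟨b1, b2, b3, b4, b5, b6, b7, b8, b9, b10, b11⟩
    have hch := sq_chain n b b1
    have h2204 := hch 2203 hn
    rw [← hpe] at h2204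
    change b 2204 = _ at h2204
    have c8 : b (n + 8) = 5 * b (n + 2) + 2 := by linarith
    have c1 : b 1 = 5 * b (n + 2) + 3 := by linarith
    have hkey : (5 * b (n + 2) + 2) * (5 * b (n + 2) + 2) * b (n + 10) + (5 * b (n + 2) + 3)
        = (5 * b (n + 2) + 3) ^ (p + 1) := by
      rw [← c1, ← h2204, ← b11, ← b10, ← b9, c8]
    have hk := mod_core p hp h5 _ _ hkey
    have c2 : b (n + 2) = t := by linarith
    have c10 : b (n + 10) = s := by
      rw [hk, show 5 * b (n + 2) + 3 = (p : ℤ) + 1 by linarith, ← hs] at hkey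
      have : (p : ℤ) * p ≠ 0 := by positivity
      exact mul_left_cancel₀ this (by linarith)
    have c1' : b 1 = p + 1 := by linarith
    have c8' : b (n + 8) = p := by linarith
    have c9 : b (n + 9) = p * p := by rw [← b9, c8']
    intro i h1 h2
    rcases cases_i i h1 h2 with ⟨k, hk, rfl⟩ | rfl | rfl | rfl | rfl | rfl | rfl | rfl | rfl |
      rfl | rfl
    · rw [hch k hk, hlow _ (by omega), c1', Nat.add_sub_cancel]
    · rw [e2, c2]
    · rw [e3]; linarith
    · rw [e4]; linarith
    · rw [e5]; linarith
    · rw [e6, b5]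
    · rw [e7]; linarith
    · rw [e8, c8']
    · rw [e9, c9]
    · rw [e10, c10]
    · rw [e11, ← b10, c9, c10]
  · intro i h1 h2
    rcases cases_i i h1 h2 with ⟨k, hk, rfl⟩ | rfl | rfl | rfl | rfl | rfl | rfl | rfl | rfl |
      rfl | rfl
    · rw [hlow _ (by omega)]; positivity
    · rw [e2]; positivity
    · rw [e3]; positivity
    · rw [e4]; positivity
    · rw [e5]; positivity
    · rw [e6]; positivity
    · rw [e7]; positivity
    · rw [e8]; positivity
    · rw [e9]; positivity
    · rw [e10]; positivity
    · rw [e11]; positivity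
  · refine ⟨n + 1, by omega, by omega, ?_⟩
    have hpe' : (p : ℤ) + 1 = 2 ^ 2203 := by exact_mod_cast hpe
    rw [hlow _ le_rfl, Nat.add_sub_cancel, hpe', ← pow_mul]
    apply pow_lt_pow_right₀ (by norm_num)
    rw [pow_add, mul_comm]
    exact Nat.mul_lt_mul_of_pos_right (by norm_num) (by positivity)

theorem stmt_0 (n : ℕ) (hn : 2203 ≤ n) :
    ∃ a : ℕ → ℤ, SolvesT n a ∧
      (∀ b : ℕ → ℤ, SolvesT n b → ∀ i, 1 ≤ i → i ≤ n + 11 → b i = a i) ∧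
      (∀ i, 1 ≤ i → i ≤ n + 11 → 0 < a i) ∧
      (∃ i, 1 ≤ i ∧ i ≤ n + 11 ∧ (2 : ℤ) ^ (2 ^ (n + 11)) < a i) := by
  have h1 : (2 ^ 2203 - 1) + 1 = 2 ^ 2203 := Nat.sub_add_cancel Nat.one_le_two_pow
  have h5 : (2 ^ 2203 - 1) % 5 = 2 := by decide +kernel
  have h2 : 2 < 2 ^ 2203 - 1 := by decide +kernel
  have hp := prime_2203
  generalize 2 ^ 2203 - 1 = p at h1 h5 h2 hp
  exact main_aux n p hn hp (by omega) h2 h1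
end

section
/- For each integer n ≥ 2203, the tuple (a_1,...,a_{n+11}) defined by: a_i = (2^2203)^(2^(i−1)) for all i ∈ {1,...,n+1}; a_{n+2} = (2^2203 − 3)/5; a_{n+3} = 2·(2^2203 − 3)/5; a_{n+4} = 4·(2^2203 − 3)/5; a_{n+5} = 2^2203 − 3; a_{n+6} = 1; a_{n+7} = 2^2203 − 2; a_{n+8} = 2^2203 − 1; a_{n+9} = (2^2203 − 1)^2; a_{n+10} = 1 + Σ_{k=2}^{2^2203} C(2^2203, k) · (2^2203 − 1)^(k−2); a_{n+11} = (2^2203)^(2^2203) − 2^2203, is a tuple of positive integers (in particular 5 divides 2^2203 − 3) and it solves the system T consisting of: x_i · x_i = x_{i+1} for all i ∈ {1,...,n}; x_{n+2} + x_{n+2} = x_{n+3}; x_{n+3} + x_{n+3} = x_{n+4}; x_{n+4} + x_{n+2} = x_{n+5}; x_{n+6} = 1; x_{n+5} + x_{n+6} = x_{n+7}; x_{n+7} + x_{n+6} = x_{n+8}; x_{n+8} + x_{n+6} = x_1; x_{n+8} · x_{n+8} = x_{n+9}; x_{n+9} · x_{n+10} = x_{n+11}; x_{n+11} + x_1 =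 x_{2204}. -/
/-- The explicit tuple `(a_1, ..., a_{n+11})` solving the system `T`. -/
def aT (n : ℕ) (i : ℕ) : ℤ :=
  if i ≤ n + 1 then ((2 : ℤ) ^ 2203) ^ (2 ^ (i - 1))
  else if i = n + 2 then ((2 : ℤ) ^ 2203 - 3) / 5
  else if i = n + 3 then 2 * (((2 : ℤ) ^ 2203 - 3) / 5)
  else if i = n + 4 then 4 * (((2 : ℤ) ^ 2203 - 3) / 5)
  else if i = n + 5 then (2 : ℤ) ^ 2203 - 3
  else if i = n + 6 then 1
  else if i = n + 7 then (2 : ℤ) ^ 2203 - 2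
  else if i = n + 8 then (2 : ℤ) ^ 2203 - 1
  else if i = n + 9 then ((2 : ℤ) ^ 2203 - 1) ^ 2
  else if i = n + 10 then
    1 + ∑ k ∈ Finset.Icc 2 (2 ^ 2203),
      ((2 ^ 2203).choose k : ℤ) * ((2 : ℤ) ^ 2203 - 1) ^ (k - 2)
  else if i = n + 11 then ((2 : ℤ) ^ 2203) ^ (2 ^ 2203) - 2 ^ 2203
  else 0

/-- The tuple with `2203` replaced by a variable exponent. -/
def aG (e n : ℕ) (i : ℕ) : ℤ :=
  if i ≤ n + 1 then ((2 : ℤ) ^ e) ^ (2 ^ (i - 1))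
  else if i = n + 2 then ((2 : ℤ) ^ e - 3) / 5
  else if i = n + 3 then 2 * (((2 : ℤ) ^ e - 3) / 5)
  else if i = n + 4 then 4 * (((2 : ℤ) ^ e - 3) / 5)
  else if i = n + 5 then (2 : ℤ) ^ e - 3
  else if i = n + 6 then 1
  else if i = n + 7 then (2 : ℤ) ^ e - 2
  else if i = n + 8 then (2 : ℤ) ^ e - 1
  else if i = n + 9 then ((2 : ℤ) ^ e - 1) ^ 2
  else if i = n + 10 then
    1 + ∑ k ∈ Finset.Icc 2 (2 ^ e),
      ((2 ^ e).choose k : ℤ) * ((2 : ℤ) ^ e - 1) ^ (k - 2)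
  else if i = n + 11 then ((2 : ℤ) ^ e) ^ (2 ^ e) - 2 ^ e
  else 0

theorem binom_key (N : ℕ) (hN : 2 ≤ N) :
    ((N : ℤ) - 1) ^ 2 * (1 + ∑ k ∈ Finset.Icc 2 N, (N.choose k : ℤ) * ((N : ℤ) - 1) ^ (k - 2))
      = (N : ℤ) ^ N - N := by
  have h := add_pow ((N : ℤ) - 1) 1 N
  rw [Finset.range_eq_Ico, Finset.sum_eq_sum_Ico_succ_bot (by omega),
    Finset.sum_eq_sum_Ico_succ_bot (by omega)] at h
  have h2 : ((N : ℤ) - 1) ^ 2 * ∑ k ∈ Finset.Icc 2 N, (N.choose k : ℤ) * ((N : ℤ) - 1) ^ (k - 2)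
      = ∑ k ∈ Finset.Ico (0 + 1 + 1) (N + 1),
          ((N : ℤ) - 1) ^ k * 1 ^ (N - k) * (N.choose k : ℤ) := by
    rw [Finset.mul_sum]
    refine Finset.sum_congr (by ext; simp) fun k hk => ?_
    obtain ⟨j, rfl⟩ : ∃ j, k = j + 2 := ⟨k - 2, by simp at hk; omega⟩
    simp only [Nat.add_sub_cancel, one_pow, pow_add]
    ring
  rw [← h2] at h
  simp at h
  rw [h]
  ring

theorem general (e n : ℕ) (he : 2 ≤ e) (hn : e ≤ n) (h5 : (5 : ℤ) ∣ (2 : ℤ) ^ e - 3)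
    (h5' : (5 : ℤ) < (2 : ℤ) ^ e - 3) :
    (∀ i, 1 ≤ i → i ≤ n + 11 → 0 < aG e n i) ∧
    (∀ i, 1 ≤ i → i ≤ n → aG e n i * aG e n i = aG e n (i + 1)) ∧
    aG e n (n + 2) + aG e n (n + 2) = aG e n (n + 3) ∧
    aG e n (n + 3) + aG e n (n + 3) = aG e n (n + 4) ∧
    aG e n (n + 4) + aG e n (n + 2) = aG e n (n + 5) ∧
    aG e n (n + 6) = 1 ∧
    aG e n (n + 5) + aG e n (n + 6) = aG e n (n + 7) ∧
    aG e n (n + 7) + aG e n (n + 6) = aG e n (n + 8) ∧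
    aG e n (n + 8) + aG e n (n + 6) = aG e n 1 ∧
    aG e n (n + 8) * aG e n (n + 8) = aG e n (n + 9) ∧
    aG e n (n + 9) * aG e n (n + 10) = aG e n (n + 11) ∧
    aG e n (n + 11) + aG e n 1 = aG e n (e + 1) := by
  have hN : 2 ≤ 2 ^ e := le_trans he (Nat.lt_two_pow_self).le
  have key := binom_key (2 ^ e) hN
  push_cast at key
  refine ⟨?_, ?_, ?_, ?_, ?_, ?_, ?_, ?_, ?_, ?_, ?_, ?_⟩
  · intro i h1 h2
    by_cases hi : i ≤ n + 1
    · simp only [aG, hi, if_true]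
      positivity
    obtain ⟨j, rfl⟩ : ∃ j, i = n + 2 + j := ⟨i - (n + 2), by omega⟩
    have hj : j ≤ 9 := by omega
    have p1 : (0 : ℤ) < 2 ^ e - 1 := by omega
    have p2 : (0 : ℤ) ≤ 2 ^ e - 1 := p1.le
    interval_cases j
    · simp only [aG, Nat.add_assoc, Nat.reduceAdd, Nat.add_le_add_iff_left, Nat.add_left_cancel_iff,
        Nat.reduceLeDiff, Nat.reduceEqDiff, if_true, if_false]
      omega
    · simp [aG, Nat.add_assoc]; omega
    · simp [aG, Nat.add_assoc]; omega
    · have : aG e n (n + 2 + 3) = 2 ^ e - 3 := by simp [aG, Nat.add_assoc]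
      omega
    · simp [aG, Nat.add_assoc]
    · have : aG e n (n + 2 + 5) = 2 ^ e - 2 := by simp [aG, Nat.add_assoc]
      omega
    · have : aG e n (n + 2 + 6) = 2 ^ e - 1 := by simp [aG, Nat.add_assoc]
      omega
    · have : aG e n (n + 2 + 7) = (2 ^ e - 1) ^ 2 := by simp [aG, Nat.add_assoc]
      rw [this]
      positivity
    · have : aG e n (n + 2 + 8) = 1 + ∑ k ∈ Finset.Icc 2 (2 ^ e),
          ((2 ^ e).choose k : ℤ) * ((2 : ℤ) ^ e - 1) ^ (k - 2) := by simp [aG, Nat.add_assoc]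
      rw [this]
      positivity
    · have h : aG e n (n + 2 + 9) = ((2 : ℤ) ^ e) ^ (2 ^ e) - 2 ^ e := by simp [aG, Nat.add_assoc]
      have : ((2 : ℤ) ^ e) ^ 1 < ((2 : ℤ) ^ e) ^ (2 ^ e) :=
        pow_lt_pow_right₀ (by omega) (by omega)
      rw [pow_one] at this
      rw [h]
      exact sub_pos.mpr this
  · intro i h1 h2
    obtain ⟨j, rfl⟩ : ∃ j, i = j + 1 := ⟨i - 1, by omega⟩
    have a1 : j + 1 ≤ n + 1 := by omega
    have a2 : j + 1 + 1 ≤ n + 1 := by omega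
    simp only [aG, a1, a2, if_true, Nat.add_sub_cancel]
    rw [← pow_add, pow_succ 2 j, mul_two]
  · simp [aG]; ring
  · simp [aG]; ring
  · simp [aG]; omega
  · simp [aG]
  · simp [aG]; ring
  · simp [aG]; ring
  · simp [aG]
  · simp [aG]; ring
  · simpa [aG] using key
  · simp [aG, hn]

set_option exponentiation.threshold 3000 in
theorem five_dvd : (5 : ℤ) ∣ (2 : ℤ) ^ 2203 - 3 := by norm_num

set_option exponentiation.threshold 3000 in
theorem five_lt : (5 : ℤ) < (2 : ℤ) ^ 2203 - 3 := by norm_num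

theorem stmt_1 (n : ℕ) (hn : 2203 ≤ n) :
    (5 : ℤ) ∣ (2 : ℤ) ^ 2203 - 3 ∧
    (∀ i, 1 ≤ i → i ≤ n + 11 → 0 < aT n i) ∧
    SolvesT n (aT n) := by
  have e : aT n = aG 2203 n := by
    funext i
    unfold aT aG
    rfl
  rw [e]
  exact ⟨five_dvd, general 2203 n (by norm_num) hn five_dvd five_lt⟩
end

section
/- If n ∈ ℕ and 2^n − 1 is prime, then the system of equations in the variables x_1,...,x_{n+8} consisting of: x_i · x_i = x_{i+1} for all i ∈ {1,...,n}; x_{n+2} = 1; x_{n+3} + x_{n+2} = x_{n+4}; x_{n+4} + x_{n+2} = x_{n+5}; x_{n+5} + x_{n+2} = x_1; x_{n+5} · x_{n+5} = x_{n+6}; x_{n+6} · x_{n+7} = x_{n+8}; x_{n+8} + x_1 = x_{n+1}, has a unique solution (x_1,...,x_{n+8}) in non-negative integers, and max(x_1,...,x_{n+8}) = x_{n+1} = (2^n)^(2^n). -/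
/-- The system from Theorem 2, in variables `x 1, ..., x (n+8)` over ℕ. -/
def Solves3 (n : ℕ) (x : ℕ → ℕ) : Prop :=
  (∀ i, 1 ≤ i → i ≤ n → x i * x i = x (i + 1)) ∧
  x (n + 2) = 1 ∧
  x (n + 3) + x (n + 2) = x (n + 4) ∧
  x (n + 4) + x (n + 2) = x (n + 5) ∧
  x (n + 5) + x (n + 2) = x 1 ∧
  x (n + 5) * x (n + 5) = x (n + 6) ∧
  x (n + 6) * x (n + 7) = x (n + 8) ∧
  x (n + 8) + x 1 = x (n + 1)

lemma aux_binom (m k : ℕ) : ∃ c, (m + 1) ^ k = 1 + k * m + m * m * c := by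
  induction k with
  | zero => exact ⟨0, by simp⟩
  | succ k ih =>
    obtain ⟨c, hc⟩ := ih
    exact ⟨k + c * m + c, by rw [pow_succ, hc]; ring⟩

lemma aux_pow (n : ℕ) (b : ℕ → ℕ) (h : ∀ i, 1 ≤ i → i ≤ n → b i * b i = b (i + 1)) :
    ∀ j, j ≤ n → b (j + 1) = b 1 ^ 2 ^ j := by
  intro j
  induction j with
  | zero => simp
  | succ j ih =>
    intro hj
    rw [← h (j + 1) (by omega) hj, ih (by omega), pow_succ 2 j, pow_mul, pow_two]

lemma aux_first (n : ℕ) (hp : Nat.Prime (2 ^ n - 1)) (b : ℕ → ℕ) (hb : Solves3 n b) :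
    b 1 = 2 ^ n := by
  obtain ⟨h0, h2, h3, h4, h5, h6, h7, h8⟩ := hb
  have hP := aux_pow n b h0 n le_rfl
  have hp2 := hp.two_le
  obtain ⟨p, hpe⟩ : ∃ p, 2 ^ n = p + 1 := ⟨2 ^ n - 1, by omega⟩
  rw [hpe] at hp hP ⊢
  simp only [Nat.add_sub_cancel] at hp
  generalize hm : b (n + 5) = m at *
  have hX : b 1 = m + 1 := by omega
  have hm2 : 2 ≤ m := by omega
  rw [hX] at hP h8
  obtain ⟨c, hc⟩ := aux_binom m (p + 1)
  rw [hP, hc, ← h7, ← h6] at h8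
  have hmpos : 0 < m := by omega
  have key : m * b (n + 7) = p + m * c := by
    apply Nat.eq_of_mul_eq_mul_left hmpos
    nlinarith
  have hdvd : m ∣ p := (Nat.dvd_add_left (Dvd.intro c rfl)).1 (key ▸ Dvd.intro _ rfl)
  rcases (Nat.dvd_prime hp).1 hdvd with h | h <;> omega

lemma aux_uniq (n : ℕ) (a b : ℕ → ℕ) (ha : Solves3 n a) (hb : Solves3 n b)
    (h1 : b 1 = a 1) : ∀ i, 1 ≤ i → i ≤ n + 8 → b i = a i := by
  obtain ⟨a0, a2, a3, a4, a5, a6, a7, a8⟩ := ha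
  obtain ⟨b0, b2, b3, b4, b5, b6, b7, b8⟩ := hb
  have hlow : ∀ j, j ≤ n → b (j + 1) = a (j + 1) := fun j hj => by
    rw [aux_pow n a a0 j hj, aux_pow n b b0 j hj, h1]
  have hn := hlow n le_rfl
  have e5 : b (n + 5) = a (n + 5) := by omega
  have e6 : b (n + 6) = a (n + 6) := by rw [← a6, ← b6, e5]
  have e8 : b (n + 8) = a (n + 8) := by omega
  have pos : 0 < a (n + 6) := by
    rw [← a6]
    have : 0 < a (n + 5) := by omega
    positivity
  have e7 : b (n + 7) = a (n + 7) := by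
    apply Nat.eq_of_mul_eq_mul_left pos
    rw [a7, ← e6, b7, e8]
  intro i hi hi'
  by_cases hle : i ≤ n + 1
  · have := hlow (i - 1) (by omega)
    rwa [Nat.sub_add_cancel hi] at this
  · obtain ⟨k, rfl⟩ : ∃ k, i = n + k := ⟨i - n, by omega⟩
    have : 2 ≤ k := by omega
    have : k ≤ 8 := by omega
    interval_cases k <;> omega

lemma aux_exists (n : ℕ) (hp : Nat.Prime (2 ^ n - 1)) : ∃ a, Solves3 n a := by
  have hp2 := hp.two_le
  obtain ⟨p, hpe⟩ : ∃ p, 2 ^ n = p + 1 := ⟨2 ^ n - 1, by omega⟩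
  have hp2' : 2 ≤ p := by omega
  obtain ⟨c, hc⟩ := aux_binom p (p + 1)
  refine ⟨fun i => if i ≤ n + 1 then (p + 1) ^ 2 ^ (i - 1) else if i = n + 2 then 1 else
    if i = n + 3 then p - 2 else if i = n + 4 then p - 1 else if i = n + 5 then p else
    if i = n + 6 then p * p else if i = n + 7 then c + 1 else p * p * (c + 1), ?_⟩
  refine ⟨?_, ?_, ?_, ?_, ?_, ?_, ?_, ?_⟩
  · intro i h1 h2
    obtain ⟨j, rfl⟩ : ∃ j, i = j + 1 := ⟨i - 1, by omega⟩
    have e1 : j + 1 ≤ n + 1 := by omega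
    have e2 : j + 1 + 1 ≤ n + 1 := by omega
    simp only [e1, e2, if_true, Nat.add_sub_cancel]
    rw [pow_succ 2 j, pow_mul, pow_two]
  all_goals simp
  · omega
  · omega
  · rw [hpe, hc]; ring

theorem stmt_3 (n : ℕ) (hp : Nat.Prime (2 ^ n - 1)) :
    ∃ a : ℕ → ℕ, Solves3 n a ∧
      (∀ b : ℕ → ℕ, Solves3 n b → ∀ i, 1 ≤ i → i ≤ n + 8 → b i = a i) ∧
      a (n + 1) = (2 ^ n) ^ (2 ^ n) ∧
      (∀ i, 1 ≤ i → i ≤ n + 8 → a i ≤ a (n + 1)) := by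
  obtain ⟨a, ha⟩ := aux_exists n hp
  have h1 := aux_first n hp a ha
  refine ⟨a, ha, fun b hb => aux_uniq n a b ha hb (by rw [h1, aux_first n hp b hb]), ?_, ?_⟩
  · rw [aux_pow n a ha.1 n le_rfl, h1]
  · obtain ⟨a0, a2, a3, a4, a5, a6, a7, a8⟩ := ha
    have hp2 := hp.two_le
    have hpos : 0 < a 1 := by omega
    have hone : 1 < a 1 := by omega
    have hlt : a 1 < a (n + 1) := by
      rw [aux_pow n a a0 n le_rfl]
      calc a 1 = a 1 ^ 1 := (pow_one _).symm
        _ < a 1 ^ 2 ^ n := Nat.pow_lt_pow_right hone (by omega)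
    have p8 : 0 < a (n + 6) * a (n + 7) := by omega
    have p6 : 0 < a (n + 6) := Nat.pos_of_mul_pos_right p8
    have p7 : 0 < a (n + 7) := Nat.pos_of_mul_pos_left p8
    have l6 : a (n + 6) ≤ a (n + 8) := a7 ▸ Nat.le_mul_of_pos_right _ p7
    have l7 : a (n + 7) ≤ a (n + 8) := a7 ▸ Nat.le_mul_of_pos_left _ p6
    intro i hi hi'
    by_cases hle : i ≤ n + 1
    · have := aux_pow n a a0 (i - 1) (by omega)
      rw [Nat.sub_add_cancel hi] at this
      rw [this, aux_pow n a a0 n le_rfl]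
      exact Nat.pow_le_pow_right hpos (Nat.pow_le_pow_right (by norm_num) (by omega))
    · obtain ⟨k, rfl⟩ : ∃ k, i = n + k := ⟨i - n, by omega⟩
      have : 2 ≤ k := by omega
      have : k ≤ 8 := by omega
      interval_cases k <;> omega
end

section
/- If n is a positive integer and 2^(2^n) + 1 is prime, then the system of equations in the variables x_1,...,x_{n+6} consisting of: x_i · x_i = x_{i+1} for all i ∈ {1,...,n}; x_{n+2} = 1; x_1 + x_{n+2} = x_{n+3}; x_{n+3} + x_{n+2} = x_{n+4}; x_{n+1} + x_{n+2} = x_{n+5}; x_{n+4} · x_{n+6} = x_{n+5}, has a unique solution (a_1,...,a_{n+6}) in non-negative integers; the numbers a_1,...,a_{n+6} are positive and max(a_1,...,a_{n+6}) = a_{n+5} = (2^(2^n) − 1)^(2^n) + 1. Explicitly, a_i = (2^(2^n) − 1)^(2^(i−1)) for i ∈ {1,...,n+1}, a_{n+2} = 1, a_{n+3} = 2^(2^n), a_{n+4} = 2^(2^n) + 1. -/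
/-- The system from Theorem 3, in variables `x 1, ..., x (n+6)` over ℕ. -/
def Solves4 (n : ℕ) (x : ℕ → ℕ) : Prop :=
  (∀ i, 1 ≤ i → i ≤ n → x i * x i = x (i + 1)) ∧
  x (n + 2) = 1 ∧
  x 1 + x (n + 2) = x (n + 3) ∧
  x (n + 3) + x (n + 2) = x (n + 4) ∧
  x (n + 1) + x (n + 2) = x (n + 5) ∧
  x (n + 4) * x (n + 6) = x (n + 5)

lemma aux_dvd (n c : ℕ) (hn : 0 < n) :
    (c + 2) ∣ c ^ 2 ^ n + 1 ↔ (c + 2) ∣ 2 ^ 2 ^ n + 1 := by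
  have he : Even (2 ^ n) := (Nat.even_pow.2 ⟨even_two, hn.ne'⟩)
  have h : ((c : ℤ) + 2) ∣ (c : ℤ) ^ 2 ^ n - 2 ^ 2 ^ n := by
    have := sub_dvd_pow_sub_pow (c : ℤ) (-2) (2 ^ n)
    rwa [he.neg_pow, sub_neg_eq_add] at this
  rw [← Int.natCast_dvd_natCast, ← Int.natCast_dvd_natCast (n := 2 ^ 2 ^ n + 1)]
  push_cast
  exact dvd_iff_dvd_of_dvd_sub (by simpa using h)

/-- The explicit solution. -/
def aux_sol (n c q i : ℕ) : ℕ :=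
  if i ≤ n + 1 then c ^ 2 ^ (i - 1) else if i = n + 2 then 1 else if i = n + 3 then c + 1
  else if i = n + 4 then c + 2 else if i = n + 5 then c ^ 2 ^ n + 1 else q

theorem stmt_4 (n : ℕ) (hn : 0 < n) (hp : Nat.Prime (2 ^ 2 ^ n + 1)) :
    ∃ a : ℕ → ℕ, Solves4 n a ∧
      (∀ b : ℕ → ℕ, Solves4 n b → ∀ i, 1 ≤ i → i ≤ n + 6 → b i = a i) ∧
      (∀ i, 1 ≤ i → i ≤ n + 6 → 0 < a i) ∧
      a (n + 5) = (2 ^ 2 ^ n - 1) ^ 2 ^ n + 1 ∧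
      (∀ i, 1 ≤ i → i ≤ n + 6 → a i ≤ a (n + 5)) ∧
      (∀ i, 1 ≤ i → i ≤ n + 1 → a i = (2 ^ 2 ^ n - 1) ^ 2 ^ (i - 1)) ∧
      a (n + 2) = 1 ∧
      a (n + 3) = 2 ^ 2 ^ n ∧
      a (n + 4) = 2 ^ 2 ^ n + 1 := by
  obtain ⟨c, hc⟩ : ∃ c, 2 ^ 2 ^ n = c + 1 := ⟨2 ^ 2 ^ n - 1, by have := Nat.one_le_two_pow (n := 2 ^ n); omega⟩
  have h2n : 2 ≤ 2 ^ n := by simpa using Nat.pow_le_pow_right (n := 2) (by norm_num) hn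
  have hc3 : 3 ≤ c := by
    have := Nat.pow_le_pow_right (n := 2) (by norm_num) h2n
    omega
  have hd : (c + 2) ∣ c ^ 2 ^ n + 1 := (aux_dvd n c hn).2 (by rw [hc])
  obtain ⟨q, hq⟩ := hd
  have hmax : c + 2 ≤ c ^ 2 ^ n + 1 := by
    have := Nat.pow_le_pow_right (n := c) (by omega) h2n
    nlinarith
  have e1 : ∀ i, i ≤ n + 1 → aux_sol n c q i = c ^ 2 ^ (i - 1) := fun i hi => by simp [aux_sol, hi]
  have e2 : aux_sol n c q (n + 2) = 1 := by simp [aux_sol]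
  have e3 : aux_sol n c q (n + 3) = c + 1 := by simp [aux_sol]
  have e4 : aux_sol n c q (n + 4) = c + 2 := by simp [aux_sol]
  have e5 : aux_sol n c q (n + 5) = c ^ 2 ^ n + 1 := by simp [aux_sol]
  have e6 : aux_sol n c q (n + 6) = q := by simp [aux_sol]
  have hcases : ∀ i, i ≤ n + 6 → i ≤ n + 1 ∨ i = n + 2 ∨ i = n + 3 ∨ i = n + 4 ∨ i = n + 5 ∨ i = n + 6 := by
    intro i hi; omega
  have hq0 : 0 < q := by
    rcases Nat.eq_zero_or_pos q with h | h
    · simp [h] at hq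
    · exact h
  refine ⟨aux_sol n c q, ⟨?_, e2, ?_, ?_, ?_, ?_⟩, ?_, ?_, ?_, ?_, ?_, e2, ?_, ?_⟩
  · intro i h1 hi
    rw [e1 i (by omega), e1 (i + 1) (by omega)]
    obtain ⟨k, rfl⟩ : ∃ k, i = k + 1 := ⟨i - 1, by omega⟩
    simp only [Nat.add_sub_cancel]
    rw [pow_succ, pow_mul, sq]
  · rw [e1 1 (by omega), e2, e3]; simp
  · rw [e3, e2, e4]
  · rw [e1 (n + 1) le_rfl, e2, e5]; simp
  · rw [e4, e5, e6, hq]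
  · rintro b ⟨hb, b2, b3, b4, b5, b6⟩
    have hpw := aux_pow n b hb
    have hn1 := hpw n le_rfl
    have hb4 : b (n + 4) = b 1 + 2 := by omega
    have hb5 : b (n + 5) = b 1 ^ 2 ^ n + 1 := by omega
    have hdv : (b 1 + 2) ∣ 2 ^ 2 ^ n + 1 :=
      (aux_dvd n (b 1) hn).1 ⟨b (n + 6), by rw [← hb4, b6, hb5]⟩
    have hb1 : b 1 = c := by
      rcases (Nat.dvd_prime hp).1 hdv with h | h <;> omega
    rw [hb1] at hb4 hb5 hpw
    intro i h1 hi
    rcases hcases i hi with h | rfl | rfl | rfl | rfl | rfl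
    · obtain ⟨k, rfl⟩ : ∃ k, i = k + 1 := ⟨i - 1, by omega⟩
      rw [e1 _ h, hpw k (by omega)]; simp
    · rw [b2, e2]
    · rw [e3]; omega
    · rw [e4, hb4]
    · rw [e5, hb5]
    · rw [e6]
      rw [hb4, hb5, hq] at b6
      exact Nat.eq_of_mul_eq_mul_left (by omega) b6
  · intro i h1 hi
    rcases hcases i hi with h | rfl | rfl | rfl | rfl | rfl
    · rw [e1 i h]; exact Nat.pow_pos (by omega)
    · omega
    · omega
    · omega
    · omega
    · omega
  · rw [e5, hc]; simp
  · intro i h1 hi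
    rw [e5]
    rcases hcases i hi with h | rfl | rfl | rfl | rfl | rfl
    · rw [e1 i h]
      have : c ^ 2 ^ (i - 1) ≤ c ^ 2 ^ n :=
        Nat.pow_le_pow_right (by omega) (Nat.pow_le_pow_right (by norm_num) (by omega))
      omega
    · omega
    · omega
    · omega
    · omega
    · rw [e6, hq]; exact Nat.le_mul_of_pos_left q (by omega)
  · intro i h1 hi
    rw [e1 i hi, hc]; simp
  · rw [e3, hc]
  · rw [e4, hc]
end

section
/- For each positive integer n, the system of equations in the variables x_1,...,x_{n+5} consisting of: x_i · x_i = x_{i+1} for all i ∈ {1,...,n}; x_{n+2} = 1; x_{n+3} + x_{n+2} = x_1; x_{n+4} + x_{n+2} = x_{n+3}; x_{n+4} · x_{n+5} = x_{n+1}, has only finitely many solutions (x_1,...,x_{n+5}) in integers; moreover, the tuple given by x_i = (2 + 2^(2^n))^(2^(i−1)) for i ∈ {1,...,n+1}, x_{n+2} = 1, x_{n+3} = 1 + 2^(2^n), x_{n+4} = 2^(2^n), x_{n+5} = (1 + 2^(2^n − 1))^(2^n) is one of these solutions. -/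
/-- The system in variables `x 1, ..., x (n+5)` over ℤ. -/
def Solves5 (n : ℕ) (x : ℕ → ℤ) : Prop :=
  (∀ i, 1 ≤ i → i ≤ n → x i * x i = x (i + 1)) ∧
  x (n + 2) = 1 ∧
  x (n + 3) + x (n + 2) = x 1 ∧
  x (n + 4) + x (n + 2) = x (n + 3) ∧
  x (n + 4) * x (n + 5) = x (n + 1)

theorem solves5_pow {n : ℕ} {x : ℕ → ℤ} (h : Solves5 n x) (i : ℕ) (hi : i ≤ n) :
    x (i + 1) = (x 1) ^ 2 ^ i := by
  induction i with
  | zero => simp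
  | succ k ih =>
    rw [← h.1 (k + 1) (by omega) hi, ih (by omega), pow_succ 2 k, pow_mul, sq]

/-- The tuple determined by the value `d` of `x (n+4)`. -/
def tup5 (n : ℕ) (d : ℤ) (j : ℕ) : ℤ :=
  if j ≤ n + 1 then (d + 2) ^ 2 ^ (j - 1)
  else if j = n + 2 then 1
  else if j = n + 3 then d + 1
  else if j = n + 4 then d
  else (d + 2) ^ 2 ^ n / d

theorem stmt_5 (n : ℕ) (hn : 0 < n) :
    -- the set of solution tuples (x_1, ..., x_{n+5}) is finite
    Set.Finite ((fun x : ℕ → ℤ => fun i : Fin (n + 5) => x (i.1 + 1)) ''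
      {x : ℕ → ℤ | Solves5 n x}) ∧
    -- the displayed tuple is a solution
    (∃ x : ℕ → ℤ, Solves5 n x ∧
      (∀ i, 1 ≤ i → i ≤ n + 1 → x i = (2 + (2 : ℤ) ^ 2 ^ n) ^ 2 ^ (i - 1)) ∧
      x (n + 2) = 1 ∧
      x (n + 3) = 1 + (2 : ℤ) ^ 2 ^ n ∧
      x (n + 4) = (2 : ℤ) ^ 2 ^ n ∧
      x (n + 5) = (1 + (2 : ℤ) ^ (2 ^ n - 1)) ^ 2 ^ n) := by
  constructor
  · have hfin : Set.Finite {d : ℤ | d ∣ 2 ^ 2 ^ n} := by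
      refine (Set.finite_Icc (-(2 : ℤ) ^ 2 ^ n) (2 ^ 2 ^ n)).subset ?_
      intro d hd
      have h1 : |d| ≤ 2 ^ 2 ^ n := Int.le_of_dvd (by positivity) ((abs_dvd _ _).2 hd)
      exact abs_le.1 h1
    refine (hfin.image (fun d => fun i : Fin (n + 5) => tup5 n d (i.1 + 1))).subset ?_
    rintro _ ⟨x, hx, rfl⟩
    have hx : Solves5 n x := hx
    have hp := solves5_pow hx
    obtain ⟨-, h2, h3, h4, h5⟩ := hx
    have e1 : x 1 = x (n + 4) + 2 := by linarith
    have hn1 := hp n le_rfl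
    rw [e1] at hn1
    have hdvd : x (n + 4) ∣ 2 ^ 2 ^ n := by
      have a1 : x (n + 4) ∣ (x (n + 4) + 2) ^ 2 ^ n := ⟨_, by rw [h5, hn1]⟩
      have a2 : x (n + 4) ∣ (x (n + 4) + 2) ^ 2 ^ n - 2 ^ 2 ^ n := by
        have := sub_dvd_pow_sub_pow (x (n + 4) + 2) 2 (2 ^ n)
        simpa using this
      exact (dvd_sub_right a1).1 a2
    have hd0 : x (n + 4) ≠ 0 := by
      intro h0
      rw [h0, zero_dvd_iff] at hdvd
      exact absurd hdvd (by positivity)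
    refine ⟨x (n + 4), hdvd, ?_⟩
    funext i
    obtain ⟨i, hi⟩ := i
    simp only [tup5]
    split_ifs with c1 c2 c3 c4
    · rw [hp i (by omega), e1]; simp
    · rw [c2, h2]
    · rw [c3]; linarith
    · rw [c4]
    · have : i + 1 = n + 5 := by omega
      rw [this, ← hn1, ← h5]
      exact Int.mul_ediv_cancel_left _ hd0
  · have hpow : (2 : ℤ) ^ 2 ^ n * (1 + (2 : ℤ) ^ (2 ^ n - 1)) ^ 2 ^ n
        = ((2 : ℤ) ^ 2 ^ n + 2) ^ 2 ^ n := by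
      rw [← mul_pow]
      congr 1
      rw [mul_add, mul_one, ← pow_succ', Nat.sub_add_cancel Nat.one_le_two_pow, add_comm]
    have hlast : tup5 n (2 ^ 2 ^ n) (n + 5) = (1 + (2 : ℤ) ^ (2 ^ n - 1)) ^ 2 ^ n := by
      simp only [tup5]
      rw [if_neg (by omega), if_neg (by omega), if_neg (by omega), if_neg (by omega), ← hpow]
      exact Int.mul_ediv_cancel_left _ (by positivity)
    have t1 : ∀ i, i ≤ n + 1 → tup5 n (2 ^ 2 ^ n) i = (2 + (2 : ℤ) ^ 2 ^ n) ^ 2 ^ (i - 1) := by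
      intro i hi
      simp only [tup5]
      rw [if_pos hi, add_comm]
    have t2 : tup5 n (2 ^ 2 ^ n) (n + 2) = 1 := by simp [tup5]
    have t3 : tup5 n (2 ^ 2 ^ n) (n + 3) = 1 + 2 ^ 2 ^ n := by simp [tup5, add_comm]
    have t4 : tup5 n (2 ^ 2 ^ n) (n + 4) = 2 ^ 2 ^ n := by simp [tup5]
    refine ⟨tup5 n (2 ^ 2 ^ n), ⟨?_, t2, ?_, ?_, ?_⟩, fun i _ hi => t1 i hi, t2, t3, t4, hlast⟩
    · intro i h1 hi
      rw [t1 i (by omega), t1 (i + 1) (by omega)]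
      obtain ⟨k, rfl⟩ : ∃ k, i = k + 1 := ⟨i - 1, by omega⟩
      simp only [Nat.add_sub_cancel]
      rw [pow_succ 2 k, pow_mul, sq]
    · rw [t3, t2, t1 1 (by omega)]; simp; ring
    · rw [t4, t2, t3]; ring
    · rw [t4, hlast, t1 (n + 1) le_rfl, hpow, add_comm]; simp
end

section
/- For every k ∈ ℕ, the equation x² + 1 = 5^(2k+1) · y² has infinitely many solutions in non-negative integers (x, y); moreover, the pair of non-negative integers x₀, y₀ determined by x₀ = ((2+√5)^(5^k) + (2−√5)^(5^k))/2 and y₀ = ((2+√5)^(5^k) − (2−√5)^(5^k))/(2·√5·5^k) is a solution, and it is minimal: every solution (x, y) in non-negative integers satisfies x ≥ x₀ and y ≥ y₀. -/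
/-- `(2 + √5) ^ n = X + Y √5`, stored as the pair `(X, Y)`. -/
def pellPair : ℕ → ℕ × ℕ
  | 0 => (1, 0)
  | n + 1 => (2 * (pellPair n).1 + 5 * (pellPair n).2, (pellPair n).1 + 2 * (pellPair n).2)

def pX (n : ℕ) : ℕ := (pellPair n).1
def pY (n : ℕ) : ℕ := (pellPair n).2

lemma pX_zero : pX 0 = 1 := rfl
lemma pY_zero : pY 0 = 0 := rfl
lemma pX_succ (n : ℕ) : pX (n + 1) = 2 * pX n + 5 * pY n := rfl
lemma pY_succ (n : ℕ) : pY (n + 1) = pX n + 2 * pY n := rfl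

lemma pX_pos (n : ℕ) : 0 < pX n := by
  induction n with
  | zero => simp [pX_zero]
  | succ n ih => rw [pX_succ]; omega

lemma pX_strictMono : StrictMono pX := by
  apply strictMono_nat_of_lt_succ
  intro n
  have := pX_pos n
  rw [pX_succ]; omega

lemma pY_mono : Monotone pY := by
  apply monotone_nat_of_le_succ
  intro n
  rw [pY_succ]; omega

lemma p_norm (n : ℕ) : (pX n : ℤ) ^ 2 - 5 * (pY n : ℤ) ^ 2 = (-1) ^ n := by
  induction n with
  | zero => simp [pX_zero, pY_zero]
  | succ n ih =>
    rw [pX_succ, pY_succ, pow_succ (-1 : ℤ) n, ← ih]; push_cast; ring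

lemma p_norm_odd {n : ℕ} (h : Odd n) : pX n ^ 2 + 1 = 5 * pY n ^ 2 := by
  have := p_norm n
  rw [h.neg_one_pow] at this
  zify; linarith

lemma p_add (m n : ℕ) : pX (m + n) = pX m * pX n + 5 * pY m * pY n ∧
    pY (m + n) = pX m * pY n + pY m * pX n := by
  induction n with
  | zero => simp [pX_zero, pY_zero]
  | succ n ih =>
    rw [← add_assoc, pX_succ, pY_succ, pX_succ, pY_succ, ih.1, ih.2]
    constructor <;> ring

lemma pY_five (m : ℕ) : pY (5 * m) =
    5 * (pY m * (pX m ^ 4 + 5 * (2 * pX m ^ 2 * pY m ^ 2 + pY m ^ 4))) := by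
  have e : 5 * m = m + (m + (m + (m + m))) := by ring
  rw [e]
  simp only [(p_add _ _).1, (p_add _ _).2]
  ring

lemma five_not_dvd_pX (n : ℕ) : ¬ 5 ∣ pX n := by
  induction n with
  | zero => simp [pX_zero]
  | succ n ih => rw [pX_succ]; omega

lemma pY_mod (n : ℕ) : 2 * pY n ≡ n * pX n [MOD 5] := by
  induction n with
  | zero => simp [pY_zero]; rfl
  | succ n ih =>
    rw [pX_succ, pY_succ]
    calc 2 * (pX n + 2 * pY n) = 2 * (2 * pY n) + 2 * pX n := by ring
      _ ≡ 2 * (n * pX n) + 2 * pX n [MOD 5] := (ih.mul_left 2).add_right _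
      _ ≡ 2 * (n * pX n) + 2 * pX n + 5 * ((n + 1) * pY n) [MOD 5] := by
          simp [Nat.ModEq]
      _ = (n + 1) * (2 * pX n + 5 * pY n) := by ring

lemma five_dvd_of {n : ℕ} (h : 5 ∣ pY n) : 5 ∣ n := by
  have h1 := (pY_mod n).dvd_iff (dvd_refl 5)
  have h2 := h1.1 (h.mul_left 2)
  rcases (Nat.Prime.dvd_mul (by norm_num)).1 h2 with h | h
  · exact h
  · exact absurd h (five_not_dvd_pX n)

lemma pow_dvd_pY (k n : ℕ) : 5 ^ k ∣ pY n ↔ 5 ^ k ∣ n := by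
  induction k generalizing n with
  | zero => simp
  | succ k ih =>
    by_cases h5 : 5 ∣ n
    · obtain ⟨m, rfl⟩ := h5
      rw [pY_five, pow_succ', Nat.mul_dvd_mul_iff_left (by norm_num),
        Nat.mul_dvd_mul_iff_left (by norm_num), ← ih m]
      refine Nat.Coprime.dvd_mul_right ?_
      apply Nat.Coprime.pow_left
      rw [Nat.Prime.coprime_iff_not_dvd (by norm_num)]
      intro h
      rw [Nat.dvd_add_left (Dvd.intro _ rfl)] at h
      exact five_not_dvd_pX m (Nat.Prime.dvd_of_dvd_pow (by norm_num) h)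
    · have hd : (5 : ℕ) ∣ 5 ^ (k + 1) := dvd_pow_self 5 (by omega)
      exact ⟨fun h => absurd (five_dvd_of (hd.trans h)) h5, fun h => absurd (hd.trans h) h5⟩

lemma p_descent (z : ℕ) : ∀ x : ℕ, (x ^ 2 + 1 = 5 * z ^ 2 ∨ x ^ 2 = 5 * z ^ 2 + 1) →
    ∃ n, x = pX n ∧ z = pY n := by
  induction z using Nat.strong_induction_on with
  | _ z ih =>
    intro x h
    rcases Nat.eq_zero_or_pos z with rfl | hz
    · refine ⟨0, ?_, rfl⟩
      rw [pX_zero]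
      rcases h with h | h
      · simp at h
      · simpa using h
    · have h1 : 2 * z ≤ x := by
        by_contra hc
        rcases h with h | h <;> nlinarith
      have h2 : 2 * x ≤ 5 * z := by
        by_contra hc
        rcases h with h | h <;> nlinarith
      have h3 : x < 3 * z := by
        by_contra hc
        rcases h with h | h <;> nlinarith
      obtain ⟨a, rfl⟩ := Nat.exists_eq_add_of_le h1
      obtain ⟨b, rfl⟩ : ∃ b, z = 2 * a + b := Nat.exists_eq_add_of_le (by omega)
      obtain ⟨n, hb, ha⟩ := ih a (by omega) b (by
        rcases h with h | h
        · right; nlinarith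
        · left; nlinarith)
      refine ⟨n + 1, ?_, ?_⟩
      · rw [pX_succ, ← hb, ← ha]; ring
      · rw [pY_succ, ← hb, ← ha]; ring

lemma p_real (n : ℕ) : (2 + Real.sqrt 5) ^ n = pX n + pY n * Real.sqrt 5 ∧
    (2 - Real.sqrt 5) ^ n = pX n - pY n * Real.sqrt 5 := by
  have h5 : Real.sqrt 5 * Real.sqrt 5 = 5 := Real.mul_self_sqrt (by norm_num)
  induction n with
  | zero => simp [pX_zero, pY_zero]
  | succ n ih =>
    rw [pow_succ, pow_succ, ih.1, ih.2, pX_succ, pY_succ]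
    push_cast
    constructor <;> linear_combination (pY n : ℝ) * h5

lemma p_sol {k n y : ℕ} (hn : Odd n) (hy : pY n = 5 ^ k * y) :
    pX n ^ 2 + 1 = 5 ^ (2 * k + 1) * y ^ 2 := by
  rw [p_norm_odd hn, hy]; ring

theorem stmt_6 (k : ℕ) :
    {p : ℕ × ℕ | p.1 ^ 2 + 1 = 5 ^ (2 * k + 1) * p.2 ^ 2}.Infinite ∧
    ∃ x₀ y₀ : ℕ,
      (x₀ : ℝ) = ((2 + Real.sqrt 5) ^ 5 ^ k + (2 - Real.sqrt 5) ^ 5 ^ k) / 2 ∧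
      (y₀ : ℝ) = ((2 + Real.sqrt 5) ^ 5 ^ k - (2 - Real.sqrt 5) ^ 5 ^ k) /
        (2 * Real.sqrt 5 * 5 ^ k) ∧
      x₀ ^ 2 + 1 = 5 ^ (2 * k + 1) * y₀ ^ 2 ∧
      ∀ x y : ℕ, x ^ 2 + 1 = 5 ^ (2 * k + 1) * y ^ 2 → x₀ ≤ x ∧ y₀ ≤ y := by
  have hodd : Odd (5 ^ k) := Odd.pow (by decide)
  have hpos : 0 < 5 ^ k := by positivity
  constructor
  · have hd : ∀ j : ℕ, ∃ y, pY (5 ^ k * (2 * j + 1)) = 5 ^ k * y := fun j =>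
      (pow_dvd_pY k _).2 (Dvd.intro _ rfl)
    choose f hf using hd
    refine Set.infinite_of_injective_forall_mem
      (f := fun j : ℕ => (pX (5 ^ k * (2 * j + 1)), f j)) ?_ ?_
    · intro i j hij
      have h1 := pX_strictMono.injective (Prod.ext_iff.1 hij).1
      have h2 := Nat.eq_of_mul_eq_mul_left hpos h1
      omega
    · intro j
      exact p_sol (hodd.mul ⟨j, rfl⟩) (hf j)
  · obtain ⟨y₀, hy₀⟩ := (pow_dvd_pY k (5 ^ k)).2 dvd_rfl
    refine ⟨pX (5 ^ k), y₀, ?_, ?_, p_sol hodd hy₀, ?_⟩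
    · rw [(p_real _).1, (p_real _).2]; ring
    · have hs : Real.sqrt 5 ≠ 0 := by positivity
      have hp : (5 : ℝ) ^ k ≠ 0 := by positivity
      rw [(p_real _).1, (p_real _).2, hy₀, eq_div_iff (by positivity)]
      push_cast
      ring
    · intro x y h
      obtain ⟨n, rfl, hn⟩ := p_descent (5 ^ k * y) x (Or.inl (by rw [h]; ring))
      have hdvd : 5 ^ k ∣ n := (pow_dvd_pY k n).1 (hn ▸ Dvd.intro _ rfl)
      have hn0 : 0 < n := by
        rcases Nat.eq_zero_or_pos n with rfl | h0
        · have hy : y = 0 := by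
            rw [pY_zero] at hn
            exact (Nat.mul_eq_zero.1 hn).resolve_left hpos.ne'
          rw [hy] at h
          simp at h
        · exact h0
      have hle := Nat.le_of_dvd hn0 hdvd
      refine ⟨pX_strictMono.monotone hle, ?_⟩
      have := pY_mono hle
      rw [hy₀, ← hn] at this
      exact Nat.le_of_mul_le_mul_left this hpos
end

section
/- If a function g : ℕ → ℕ has a single-fold Diophantine representation, then there exists a positive integer m such that g(n) < f(n) for every integer n ≥ m. -/
/-- An equation from `E_n`: one of `x k = 1`, `x i + x j = x k`, `x i * x j = x k`
with `i, j, k ∈ {1, ..., n}` (indices are represented by `Fin n`). -/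
inductive Eqn (n : ℕ) where
  | one (k : Fin n)
  | add (i j k : Fin n)
  | mul (i j k : Fin n)

/-- A tuple satisfies a single equation. -/
def Eqn.Holds {n : ℕ} {α : Type*} [One α] [Add α] [Mul α] (x : Fin n → α) :
    Eqn n → Prop
  | .one k => x k = 1
  | .add i j k => x i + x j = x k
  | .mul i j k => x i * x j = x k

/-- A tuple solves a system `S ⊆ E_n`. -/
def Solves {n : ℕ} {α : Type*} [One α] [Add α] [Mul α] (S : Set (Eqn n))
    (x : Fin n → α) : Prop :=
  ∀ e ∈ S, e.Holds x

/-- `f n` is the smallest `b` such that for each system `S ⊆ E_n` with a unique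
solution in non-negative integers, this solution belongs to `[0, b]^n`. -/
noncomputable def f (n : ℕ) : ℕ :=
  sInf {b : ℕ | ∀ S : Set (Eqn n), ∀ x : Fin n → ℕ,
    Solves S x → (∀ y : Fin n → ℕ, Solves S y → y = x) → ∀ i, x i ≤ b}

/-- `g : ℕ → ℕ` has a single-fold Diophantine representation. -/
def SingleFoldRep (g : ℕ → ℕ) : Prop :=
  ∃ (m : ℕ) (W : MvPolynomial (Fin (m + 2)) ℤ),
    (∀ a b : ℕ, g a = b ↔ ∃ x : Fin m → ℕ,
      MvPolynomial.eval (Fin.cons (a : ℤ) (Fin.cons (b : ℤ) (fun i => (x i : ℤ)))) W = 0) ∧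
    (∀ a b : ℕ, ∀ x y : Fin m → ℕ,
      MvPolynomial.eval (Fin.cons (a : ℤ) (Fin.cons (b : ℤ) (fun i => (x i : ℤ)))) W = 0 →
      MvPolynomial.eval (Fin.cons (a : ℤ) (Fin.cons (b : ℤ) (fun i => (y i : ℤ)))) W = 0 →
      x = y)

/-- Arithmetic expressions in `k` variables. -/
inductive AExpr (k : ℕ) where
  | zero
  | one
  | var (i : Fin k)
  | add (a b : AExpr k)
  | mul (a b : AExpr k)

noncomputable instance (k : ℕ) : DecidableEq (AExpr k) := Classical.decEq _

namespace AExpr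

def ev {k : ℕ} (v : Fin k → ℕ) : AExpr k → ℕ
  | zero => 0
  | one => 1
  | var i => v i
  | add a b => ev v a + ev v b
  | mul a b => ev v a * ev v b

noncomputable def sub {k : ℕ} : AExpr k → Finset (AExpr k)
  | zero => {zero}
  | one => {one}
  | var i => {var i}
  | add a b => insert (add a b) (sub a ∪ sub b)
  | mul a b => insert (mul a b) (sub a ∪ sub b)

theorem self_mem_sub {k : ℕ} (a : AExpr k) : a ∈ sub a := by
  cases a <;> simp [sub]

/-- Closed under immediate subexpressions. -/
def Closed {k : ℕ} (T : Finset (AExpr k)) : Prop :=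
  (∀ a b, add a b ∈ T → a ∈ T ∧ b ∈ T) ∧ (∀ a b, mul a b ∈ T → a ∈ T ∧ b ∈ T)

theorem Closed.union {k : ℕ} {T U : Finset (AExpr k)} (hT : Closed T) (hU : Closed U) :
    Closed (T ∪ U) := by
  constructor
  · intro a b h
    rcases Finset.mem_union.1 h with h | h
    · exact ⟨Finset.mem_union_left _ (hT.1 a b h).1, Finset.mem_union_left _ (hT.1 a b h).2⟩
    · exact ⟨Finset.mem_union_right _ (hU.1 a b h).1, Finset.mem_union_right _ (hU.1 a b h).2⟩
  · intro a b h
    rcases Finset.mem_union.1 h with h | h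
    · exact ⟨Finset.mem_union_left _ (hT.2 a b h).1, Finset.mem_union_left _ (hT.2 a b h).2⟩
    · exact ⟨Finset.mem_union_right _ (hU.2 a b h).1, Finset.mem_union_right _ (hU.2 a b h).2⟩

theorem closed_sub {k : ℕ} (e : AExpr k) : Closed (sub e) := by
  induction e with
  | zero => simp [Closed, sub]
  | one => simp [Closed, sub]
  | var i => simp [Closed, sub]
  | add a b iha ihb =>
    have h := iha.union ihb
    have ha := self_mem_sub a
    have hb := self_mem_sub b
    constructor
    · intro c d hcd
      simp only [sub, Finset.mem_insert, add.injEq] at hcd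
      rcases hcd with ⟨rfl, rfl⟩ | hcd
      · simp [sub, ha, hb]
      · exact ⟨Finset.mem_insert_of_mem (h.1 c d hcd).1, Finset.mem_insert_of_mem (h.1 c d hcd).2⟩
    · intro c d hcd
      simp only [sub, Finset.mem_insert, reduceCtorEq, false_or] at hcd
      exact ⟨Finset.mem_insert_of_mem (h.2 c d hcd).1, Finset.mem_insert_of_mem (h.2 c d hcd).2⟩
  | mul a b iha ihb =>
    have h := iha.union ihb
    have ha := self_mem_sub a
    have hb := self_mem_sub b
    constructor
    · intro c d hcd
      simp only [sub, Finset.mem_insert, reduceCtorEq, false_or] at hcd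
      exact ⟨Finset.mem_insert_of_mem (h.1 c d hcd).1, Finset.mem_insert_of_mem (h.1 c d hcd).2⟩
    · intro c d hcd
      simp only [sub, Finset.mem_insert, mul.injEq] at hcd
      rcases hcd with ⟨rfl, rfl⟩ | hcd
      · simp [sub, ha, hb]
      · exact ⟨Finset.mem_insert_of_mem (h.2 c d hcd).1, Finset.mem_insert_of_mem (h.2 c d hcd).2⟩

theorem exists_num (k s : ℕ) : ∀ n : ℕ, n < 2 ^ s →
    ∃ E : AExpr k, (∀ v, ev v E = n) ∧ (sub E).card ≤ 3 * s + 1 := by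
  induction s with
  | zero =>
    intro n hn
    refine ⟨zero, fun v => ?_, by simp [sub]⟩
    simp at hn
    simp [ev, hn]
  | succ s ih =>
    intro n hn
    obtain ⟨E, hE, hc⟩ := ih (n / 2) (by rw [pow_succ] at hn; omega)
    have h1 : (sub (add E E)).card ≤ (sub E).card + 1 := by
      simp only [sub, Finset.union_self]
      exact Finset.card_insert_le _ _
    rcases Nat.mod_two_eq_zero_or_one n with h | h
    · refine ⟨add E E, fun v => ?_, by omega⟩
      simp only [ev, hE]; omega
    · refine ⟨add (add E E) one, fun v => ?_, ?_⟩
      · simp only [ev, hE]; omega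
      · have h2 : (sub (add (add E E) one)).card ≤ (sub (add E E) ∪ sub one).card + 1 :=
          Finset.card_insert_le _ _
        have h3 := Finset.card_union_le (sub (add E E)) (sub (one : AExpr k))
        have h4 : (sub (one : AExpr k)).card = 1 := by simp [sub]
        omega

theorem exists_poly {k : ℕ} (W : MvPolynomial (Fin k) ℤ) :
    ∃ P Q : AExpr k, ∀ v : Fin k → ℕ,
      MvPolynomial.eval (fun i => (v i : ℤ)) W = (ev v P : ℤ) - (ev v Q : ℤ) := by
  induction W using MvPolynomial.induction_on with
  | C a =>
    obtain ⟨P, hP, -⟩ := exists_num k a.toNat a.toNat Nat.lt_two_pow_self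
    obtain ⟨Q, hQ, -⟩ := exists_num k (-a).toNat (-a).toNat Nat.lt_two_pow_self
    refine ⟨P, Q, fun v => ?_⟩
    rw [hP, hQ, MvPolynomial.eval_C]
    omega
  | add p q hp hq =>
    obtain ⟨P, Q, h⟩ := hp
    obtain ⟨P', Q', h'⟩ := hq
    refine ⟨add P P', add Q Q', fun v => ?_⟩
    rw [map_add, h, h']
    simp only [ev]
    push_cast
    ring
  | mul_X p i hp =>
    obtain ⟨P, Q, h⟩ := hp
    refine ⟨mul P (var i), mul Q (var i), fun v => ?_⟩
    rw [map_mul, h, MvPolynomial.eval_X]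
    simp only [ev]
    push_cast
    ring

/-- The system attached to a labelling `e` of variables by expressions and a relation `R`
of expressions that are required to be equal. -/
def sys {k n : ℕ} (e : Fin n → AExpr k) (R : AExpr k → AExpr k → Prop) : Set (Eqn n) :=
  fun q => match q with
  | .one i => e i = one
  | .add i j l => e l = add (e i) (e j) ∨ (e j = zero ∧ (e i = e l ∨ R (e i) (e l)))
  | .mul i j l => e l = mul (e i) (e j)

theorem solves_sys_of {k n : ℕ} (e : Fin n → AExpr k) (R : AExpr k → AExpr k → Prop)
    (v : Fin k → ℕ) (hR : ∀ a b, R a b → ev v a = ev v b) :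
    Solves (sys e R) (fun i => ev v (e i)) := by
  intro q hq
  cases q with
  | one i =>
    have h : e i = one := hq
    simp [Eqn.Holds, h, ev]
  | add i j l =>
    have h : e l = add (e i) (e j) ∨ (e j = zero ∧ (e i = e l ∨ R (e i) (e l))) := hq
    rcases h with h | ⟨h, h' | h'⟩
    · simp [Eqn.Holds, h, ev]
    · simp [Eqn.Holds, h, h', ev]
    · simp [Eqn.Holds, h, hR _ _ h', ev]
  | mul i j l =>
    have h : e l = mul (e i) (e j) := hq
    simp [Eqn.Holds, h, ev]

theorem of_solves_sys {k n : ℕ} (T : Finset (AExpr k)) (hT : Closed T) (hz : zero ∈ T)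
    (hv : ∀ i, var i ∈ T) (e : Fin n → AExpr k) (he : ∀ i, e i ∈ T)
    (hs : ∀ a ∈ T, ∃ i, e i = a) (R : AExpr k → AExpr k → Prop)
    (x : Fin n → ℕ) (hx : Solves (sys e R) x) :
    ∃ v : Fin k → ℕ, (∀ i, x i = ev v (e i)) ∧
      ∀ a ∈ T, ∀ b ∈ T, R a b → ev v a = ev v b := by
  obtain ⟨z, hz⟩ := hs zero hz
  choose c hc using fun i => hs _ (hv i)
  have hx1 : ∀ i, e i = one → x i = 1 := fun i h => hx (.one i) h
  have hxa : ∀ i j l, e l = add (e i) (e j) ∨ (e j = zero ∧ (e i = e l ∨ R (e i) (e l))) →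
    x i + x j = x l := fun i j l h => hx (.add i j l) h
  have hxm : ∀ i j l, e l = mul (e i) (e j) → x i * x j = x l := fun i j l h => hx (.mul i j l) h
  have hxz : x z = 0 := by
    have := hxa z z z (Or.inr ⟨hz, Or.inl rfl⟩)
    omega
  have key : ∀ a : AExpr k, ∀ i, e i = a → x i = ev (fun i => x (c i)) a := by
    intro a
    induction a with
    | zero =>
      intro i hi
      have := hxa z z i (Or.inr ⟨hz, Or.inl (hz.trans hi.symm)⟩)
      simp only [ev]; omega
    | one => intro i hi; exact hx1 i hi
    | var j =>
      intro i hi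
      have := hxa (c j) z i (Or.inr ⟨hz, Or.inl ((hc j).trans hi.symm)⟩)
      simp only [ev]; omega
    | add a b iha ihb =>
      intro i hi
      have hm := hT.1 a b (hi ▸ he i)
      obtain ⟨p, hp⟩ := hs a hm.1
      obtain ⟨q, hq⟩ := hs b hm.2
      have := hxa p q i (Or.inl (by rw [hp, hq, hi]))
      rw [← this, iha p hp, ihb q hq, ev]
    | mul a b iha ihb =>
      intro i hi
      have hm := hT.2 a b (hi ▸ he i)
      obtain ⟨p, hp⟩ := hs a hm.1
      obtain ⟨q, hq⟩ := hs b hm.2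
      have := hxm p q i (by rw [hp, hq, hi])
      rw [← this, iha p hp, ihb q hq, ev]
  refine ⟨fun i => x (c i), fun i => key _ i rfl, ?_⟩
  intro a ha b hb hab
  obtain ⟨p, hp⟩ := hs a ha
  obtain ⟨q, hq⟩ := hs b hb
  have := hxa p z q (Or.inr ⟨hz, Or.inr (by rw [hp, hq]; exact hab)⟩)
  rw [← key a p hp, ← key b q hq]
  omega

end AExpr

theorem eqn_finite (n : ℕ) : Finite (Eqn n) := by
  let F : Eqn n → Fin n ⊕ (Fin n × Fin n × Fin n) ⊕ (Fin n × Fin n × Fin n) := fun q =>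
    match q with
    | .one k => Sum.inl k
    | .add i j k => Sum.inr (Sum.inl (i, j, k))
    | .mul i j k => Sum.inr (Sum.inr (i, j, k))
  refine Finite.of_injective F ?_
  intro p q h
  cases p <;> cases q <;> simp_all [F]

theorem le_f {n : ℕ} (S : Set (Eqn n)) (x : Fin n → ℕ) (hx : Solves S x)
    (hu : ∀ y : Fin n → ℕ, Solves S y → y = x) (i : Fin n) : x i ≤ f n := by
  have hne : {b : ℕ | ∀ S : Set (Eqn n), ∀ x : Fin n → ℕ,
      Solves S x → (∀ y : Fin n → ℕ, Solves S y → y = x) → ∀ i, x i ≤ b}.Nonempty := by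
    have := eqn_finite n
    classical
    have h : ∀ S : Set (Eqn n), ∃ b : ℕ, ∀ x : Fin n → ℕ,
        Solves S x → (∀ y : Fin n → ℕ, Solves S y → y = x) → ∀ i, x i ≤ b := by
      intro S
      by_cases hS : ∃ x : Fin n → ℕ, Solves S x
      · obtain ⟨x, hx⟩ := hS
        refine ⟨∑ i, x i, fun y _ hy' i => ?_⟩
        rw [← hy' x hx]
        exact Finset.single_le_sum (f := x) (fun _ _ => Nat.zero_le _) (Finset.mem_univ i)
      · exact ⟨0, fun x hx => absurd ⟨x, hx⟩ hS⟩
    choose B hB using h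
    obtain ⟨M, hM⟩ := (Set.finite_range B).bddAbove
    exact ⟨M, fun S x hx hu i => (hB S x hx hu i).trans (hM ⟨S, rfl⟩)⟩
  exact Nat.sInf_mem hne S x hx hu i

theorem growth (C s : ℕ) (hs : C + 5 ≤ s) : 3 * s + 4 + C < 2 ^ s := by
  induction s, hs using Nat.le_induction with
  | base =>
    have : C < 2 ^ C := Nat.lt_two_pow_self
    rw [pow_add]; omega
  | succ s hs ih => rw [pow_succ]; omega

theorem exists_labelling {α : Type*} [DecidableEq α] (T : Finset α) (n : ℕ) (hT : T.Nonempty)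
    (hn : T.card ≤ n) : ∃ e : Fin n → α, (∀ i, e i ∈ T) ∧ ∀ a ∈ T, ∃ i, e i = a := by
  obtain ⟨t, ht⟩ := hT
  refine ⟨fun i => if h : i.1 < T.card then (T.equivFin.symm ⟨i.1, h⟩).1 else t, ?_, ?_⟩
  · intro i
    dsimp only
    split
    · exact Subtype.property _
    · exact ht
  · intro a ha
    refine ⟨⟨(T.equivFin ⟨a, ha⟩).1, (T.equivFin ⟨a, ha⟩).2.trans_le hn⟩, ?_⟩
    simp

open AExpr

theorem stmt_8 (g : ℕ → ℕ) (hg : SingleFoldRep g) :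
    ∃ m : ℕ, 0 < m ∧ ∀ n : ℕ, m ≤ n → g n < f n := by
  obtain ⟨m, W, hW, hU⟩ := hg
  obtain ⟨P, Q, hPQ⟩ := exists_poly W
  have hcast : ∀ (a b : ℕ) (x : Fin m → ℕ),
      (Fin.cons (a : ℤ) (Fin.cons (b : ℤ) (fun i => (x i : ℤ))) : Fin (m + 2) → ℤ) =
      fun i => (((Fin.cons a (Fin.cons b x) : Fin (m + 2) → ℕ) i : ℕ) : ℤ) := by
    intro a b x
    funext i
    refine Fin.cases ?_ (fun i => ?_) i
    · simp
    · refine Fin.cases ?_ (fun i => ?_) i <;> simp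
  have hev : ∀ (a b : ℕ) (x : Fin m → ℕ),
      MvPolynomial.eval (Fin.cons (a : ℤ) (Fin.cons (b : ℤ) (fun i => (x i : ℤ)))) W = 0 ↔
      ev (Fin.cons a (Fin.cons b x) : Fin (m + 2) → ℕ) P = ev (Fin.cons a (Fin.cons b x)) Q := by
    intro a b x
    rw [hcast, hPQ]
    omega
  simp only [hev] at hW hU
  let v0 : AExpr (m + 2) := var 0
  let top : AExpr (m + 2) := add (var 1) one
  let B : Finset (AExpr (m + 2)) :=
    sub P ∪ sub Q ∪ sub top ∪ sub zero ∪ Finset.univ.image var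
  have hB : Closed B := by
    refine ((((closed_sub P).union (closed_sub Q)).union (closed_sub top)).union
      (closed_sub zero)).union ?_
    simp [Closed]
  refine ⟨3 * (B.card + 5) + 1 + B.card, by omega, fun n hn => ?_⟩
  obtain ⟨s, hs1, hs2⟩ : ∃ s, 3 * s + 1 + B.card ≤ n ∧ n < 2 ^ s := by
    refine ⟨(n - 1 - B.card) / 3, by omega, ?_⟩
    have := growth B.card ((n - 1 - B.card) / 3) (by omega)
    omega
  obtain ⟨N, hN, hNc⟩ := exists_num (m + 2) s n hs2
  have hTc : Closed (B ∪ sub N) := hB.union (closed_sub N)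
  have hcard := Finset.card_union_le B (sub N)
  have hz : zero ∈ B ∪ sub N := by simp [B, sub]
  have hvar : ∀ i, var i ∈ B ∪ sub N := fun i => by simp [B]
  have hP : P ∈ B ∪ sub N := by simp [B, self_mem_sub P]
  have hQ : Q ∈ B ∪ sub N := by simp [B, self_mem_sub Q]
  have htop : top ∈ B ∪ sub N := by simp [B, self_mem_sub top]
  have hNm : N ∈ B ∪ sub N := by simp [self_mem_sub N]
  obtain ⟨e, he, hes⟩ := exists_labelling (B ∪ sub N) n ⟨_, hz⟩ (by omega)
  let R : AExpr (m + 2) → AExpr (m + 2) → Prop := fun a b => (a = P ∧ b = Q) ∨ (a = v0 ∧ b = N)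
  obtain ⟨w, hw⟩ := (hW n (g n)).1 rfl
  let u : Fin (m + 2) → ℕ := Fin.cons n (Fin.cons (g n) w)
  have hsol : Solves (sys e R) (fun i => ev u (e i)) := by
    apply solves_sys_of
    rintro a b (⟨rfl, rfl⟩ | ⟨rfl, rfl⟩)
    · exact hw
    · rw [hN]; simp [v0, ev, u]
  obtain ⟨i, hi⟩ := hes top htop
  have hle := le_f (sys e R) _ hsol ?_ i
  · have : ev u (e i) = g n + 1 := by
      rw [hi]
      simp only [top, ev, u]
      rfl
    omega
  · intro y hy
    obtain ⟨v, hv1, hv2⟩ := of_solves_sys _ hTc hz hvar e he hes R y hy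
    have h1 := hv2 P hP Q hQ (Or.inl ⟨rfl, rfl⟩)
    have h2 := hv2 v0 (hvar 0) N hNm (Or.inr ⟨rfl, rfl⟩)
    rw [hN] at h2
    have h2 : v 0 = n := h2
    have hvc : v = Fin.cons n (Fin.cons (v 1) (fun i => v i.succ.succ)) := by
      funext j
      refine Fin.cases ?_ (fun j => ?_) j
      · simpa using h2
      · refine Fin.cases ?_ (fun j => ?_) j
        · simp
        · simp
    rw [hvc] at h1
    have hg1 : g n = v 1 := (hW n (v 1)).2 ⟨_, h1⟩
    rw [← hg1] at h1 hvc
    have hx := hU n (g n) _ _ h1 hw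
    rw [hx] at hvc
    funext j
    rw [hv1, hvc]
end

section
/- If a function g : ℕ → ℕ has a finite-fold Diophantine representation, then there exists a positive integer m such that g(n) < f_ω(n) for every integer n ≥ m. -/
/-- `fOmega n` is the smallest `b` such that for each system `S ⊆ E_n` which has at
least one and only finitely many solutions in non-negative integers, some solution
has all coordinates `≤ b`. -/
noncomputable def fOmega (n : ℕ) : ℕ :=
  sInf {b : ℕ | ∀ S : Set (Eqn n),
    {x : Fin n → ℕ | Solves S x}.Nonempty →
    {x : Fin n → ℕ | Solves S x}.Finite →
    ∃ x : Fin n → ℕ, Solves S x ∧ ∀ i, x i ≤ b}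

/-- `g : ℕ → ℕ` has a finite-fold Diophantine representation. -/
def FiniteFoldRep (g : ℕ → ℕ) : Prop :=
  ∃ (m : ℕ) (W : MvPolynomial (Fin (m + 2)) ℤ),
    (∀ a b : ℕ, g a = b ↔ ∃ x : Fin m → ℕ,
      MvPolynomial.eval (Fin.cons (a : ℤ) (Fin.cons (b : ℤ) (fun i => (x i : ℤ)))) W = 0) ∧
    (∀ a b : ℕ, {x : Fin m → ℕ |
      MvPolynomial.eval (Fin.cons (a : ℤ) (Fin.cons (b : ℤ) (fun i => (x i : ℤ)))) W = 0}.Finite)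

/-- `φ` respects all the elementary equations among the members of `F`. -/
def Resp {σ : Type} (F : Set (MvPolynomial σ ℕ)) (φ : MvPolynomial σ ℕ → ℕ) : Prop :=
  (1 ∈ F → φ 1 = 1) ∧
  (∀ p q, p ∈ F → q ∈ F → p + q ∈ F → φ p + φ q = φ (p + q)) ∧
  (∀ p q, p ∈ F → q ∈ F → p * q ∈ F → φ p * φ q = φ (p * q))

/-- The elementary equations among members of `F` determine all values on `F`. -/
def Good {σ : Type} (F : Set (MvPolynomial σ ℕ)) : Prop :=
  ∀ φ, Resp F φ → ∀ q ∈ F, φ q = MvPolynomial.eval (fun i => φ (MvPolynomial.X i)) q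

theorem Resp.mono {σ : Type} {F G : Set (MvPolynomial σ ℕ)} {φ} (h : Resp G φ) (hs : F ⊆ G) :
    Resp F φ :=
  ⟨fun h1 => h.1 (hs h1), fun p q a b c => h.2.1 p q (hs a) (hs b) (hs c),
    fun p q a b c => h.2.2 p q (hs a) (hs b) (hs c)⟩

theorem Good.union {σ : Type} {F G : Set (MvPolynomial σ ℕ)} (hF : Good F) (hG : Good G) :
    Good (F ∪ G) := by
  rintro φ h q (hq | hq)
  · exact hF φ (h.mono Set.subset_union_left) q hq
  · exact hG φ (h.mono Set.subset_union_right) q hq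

theorem Good.insert_add {σ : Type} {F : Set (MvPolynomial σ ℕ)} (hF : Good F) {p q}
    (hp : p ∈ F) (hq : q ∈ F) : Good (insert (p + q) F) := by
  intro φ h r hr
  have h' := hF φ (h.mono (Set.subset_insert _ _))
  rcases hr with rfl | hr
  · rw [← h.2.1 p q (.inr hp) (.inr hq) (.inl rfl), h' p hp, h' q hq, map_add]
  · exact h' r hr

theorem Good.insert_mul {σ : Type} {F : Set (MvPolynomial σ ℕ)} (hF : Good F) {p q}
    (hp : p ∈ F) (hq : q ∈ F) : Good (insert (p * q) F) := by
  intro φ h r hr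
  have h' := hF φ (h.mono (Set.subset_insert _ _))
  rcases hr with rfl | hr
  · rw [← h.2.2 p q (.inr hp) (.inr hq) (.inl rfl), h' p hp, h' q hq, map_mul]
  · exact h' r hr

theorem good_X {σ : Type} (i : σ) : Good {(MvPolynomial.X i : MvPolynomial σ ℕ)} := by
  rintro φ h q rfl
  simp

theorem good_zero {σ : Type} : Good {(0 : MvPolynomial σ ℕ)} := by
  rintro φ h q rfl
  have := h.2.1 0 0 rfl rfl (by simp)
  simp at this
  simp [this]

theorem good_one {σ : Type} : Good {(1 : MvPolynomial σ ℕ)} := by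
  rintro φ h q rfl
  have := h.1 rfl
  simp [this]

/-- The numerals `0, ..., q + 1`. -/
def numerals (σ : Type) (q : ℕ) : Set (MvPolynomial σ ℕ) :=
  (fun j : ℕ => (j : MvPolynomial σ ℕ)) '' Set.Iio (q + 2)

theorem mem_numerals {σ : Type} {q j : ℕ} (h : j < q + 2) :
    (j : MvPolynomial σ ℕ) ∈ numerals σ q := ⟨j, h, rfl⟩

theorem good_numerals {σ : Type} (q : ℕ) : Good (numerals σ q) := by
  induction q with
  | zero =>
    have : numerals σ 0 = {0} ∪ {1} := by
      ext p
      simp only [numerals, Set.mem_image, Set.mem_Iio, Set.mem_union, Set.mem_singleton_iff]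
      constructor
      · rintro ⟨j, hj, rfl⟩
        interval_cases j <;> simp
      · rintro (rfl | rfl)
        · exact ⟨0, by simp⟩
        · exact ⟨1, by simp⟩
    rw [this]
    exact good_zero.union good_one
  | succ q ih =>
    have : numerals σ (q + 1) =
        insert (((q + 1 : ℕ) : MvPolynomial σ ℕ) + ((1 : ℕ) : MvPolynomial σ ℕ))
          (numerals σ q) := by
      rw [← Nat.cast_add]
      ext p
      simp only [numerals, Set.mem_image, Set.mem_Iio, Set.mem_insert_iff]
      constructor
      · rintro ⟨j, hj, rfl⟩
        rcases Nat.lt_succ_iff_lt_or_eq.1 hj with h | h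
        · exact .inr ⟨j, h, rfl⟩
        · exact .inl (by rw [h])
      · rintro (rfl | ⟨j, hj, rfl⟩)
        · exact ⟨_, by omega, rfl⟩
        · exact ⟨j, by omega, rfl⟩
    rw [this]
    exact ih.insert_add (mem_numerals (by omega)) (mem_numerals (by omega))

theorem finite_numerals {σ : Type} (q : ℕ) : (numerals σ q).Finite :=
  (Set.finite_Iio _).image _

theorem ncard_numerals {σ : Type} (q : ℕ) : (numerals σ q).ncard ≤ q + 2 := by
  refine (Set.ncard_image_le (Set.finite_Iio _)).trans ?_
  simp

theorem exists_good {σ : Type} (p : MvPolynomial σ ℕ) :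
    ∃ F : Set (MvPolynomial σ ℕ), F.Finite ∧ p ∈ F ∧ Good F := by
  induction p using MvPolynomial.induction_on with
  | C a =>
    refine ⟨numerals σ a, finite_numerals a, ?_, good_numerals a⟩
    have := mem_numerals (σ := σ) (q := a) (j := a) (by omega)
    simpa using this
  | add p q hp hq =>
    obtain ⟨F, hF, hpF, gF⟩ := hp
    obtain ⟨G, hG, hqG, gG⟩ := hq
    exact ⟨_, (hF.union hG).insert _, .inl rfl, (gF.union gG).insert_add (.inl hpF) (.inr hqG)⟩
  | mul_X p i hp =>
    obtain ⟨F, hF, hpF, gF⟩ := hp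
    exact ⟨_, (hF.union (Set.finite_singleton _)).insert _, .inl rfl,
      (gF.union (good_X i)).insert_mul (.inl hpF) (.inr rfl)⟩

theorem exists_split {σ : Type} (W : MvPolynomial σ ℤ) :
    ∃ P Q : MvPolynomial σ ℕ, ∀ v : σ → ℕ,
      MvPolynomial.eval (fun i => (v i : ℤ)) W =
        (MvPolynomial.eval v P : ℤ) - (MvPolynomial.eval v Q : ℤ) := by
  induction W using MvPolynomial.induction_on with
  | C a =>
    refine ⟨MvPolynomial.C a.toNat, MvPolynomial.C (-a).toNat, fun v => ?_⟩
    simp only [MvPolynomial.eval_C]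
    omega
  | add p q hp hq =>
    obtain ⟨P, Q, h⟩ := hp
    obtain ⟨P', Q', h'⟩ := hq
    refine ⟨P + P', Q + Q', fun v => ?_⟩
    simp only [map_add, h, h']
    push_cast
    ring
  | mul_X p i hp =>
    obtain ⟨P, Q, h⟩ := hp
    refine ⟨P * MvPolynomial.X i, Q * MvPolynomial.X i, fun v => ?_⟩
    simp only [map_mul, h, MvPolynomial.eval_X]
    push_cast
    ring

instance (n : ℕ) : Finite (Eqn n) := by
  let f : Eqn n → Fin n ⊕ (Fin n × Fin n × Fin n) ⊕ (Fin n × Fin n × Fin n) := fun e =>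
    match e with
    | .one k => .inl k
    | .add i j k => .inr (.inl (i, j, k))
    | .mul i j k => .inr (.inr (i, j, k))
  refine Finite.of_injective f ?_
  rintro (_ | _ | _) (_ | _ | _) h <;> simp_all [f]

theorem fOmega_spec (n : ℕ) : ∀ S : Set (Eqn n),
    {x : Fin n → ℕ | Solves S x}.Nonempty →
    {x : Fin n → ℕ | Solves S x}.Finite →
    ∃ x : Fin n → ℕ, Solves S x ∧ ∀ i, x i ≤ fOmega n := by
  refine Nat.sInf_mem (s := {b : ℕ | ∀ S : Set (Eqn n),
    {x : Fin n → ℕ | Solves S x}.Nonempty →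
    {x : Fin n → ℕ | Solves S x}.Finite →
    ∃ x : Fin n → ℕ, Solves S x ∧ ∀ i, x i ≤ b}) ?_
  have h : ∀ S : Set (Eqn n), ∃ b : ℕ, {x : Fin n → ℕ | Solves S x}.Nonempty →
      ∃ x : Fin n → ℕ, Solves S x ∧ ∀ i, x i ≤ b := by
    intro S
    by_cases hS : {x : Fin n → ℕ | Solves S x}.Nonempty
    · obtain ⟨x, hx⟩ := hS
      exact ⟨∑ i, x i, fun _ => ⟨x, hx, fun i =>
        Finset.single_le_sum (f := x) (fun _ _ => Nat.zero_le _) (Finset.mem_univ i)⟩⟩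
    · exact ⟨0, fun h => absurd h hS⟩
  choose b hb using h
  obtain ⟨B, hB⟩ := (Set.finite_range b).bddAbove
  refine ⟨B, fun S h1 _ => ?_⟩
  obtain ⟨x, hx, hxb⟩ := hb S h1
  exact ⟨x, hx, fun i => (hxb i).trans (hB ⟨S, rfl⟩)⟩

theorem holds_eval {σ : Type} {n : ℕ} (L : Fin n → MvPolynomial σ ℕ) (v : σ → ℕ) (e : Eqn n)
    (h : e.Holds L) : e.Holds (fun i => MvPolynomial.eval v (L i)) := by
  cases e with
  | one k =>
    have h : L k = 1 := h
    show MvPolynomial.eval v (L k) = 1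
    rw [h, map_one]
  | add i j k =>
    have h : L i + L j = L k := h
    show MvPolynomial.eval v (L i) + MvPolynomial.eval v (L j) = MvPolynomial.eval v (L k)
    rw [← h, map_add]
  | mul i j k =>
    have h : L i * L j = L k := h
    show MvPolynomial.eval v (L i) * MvPolynomial.eval v (L j) = MvPolynomial.eval v (L k)
    rw [← h, map_mul]

/-- Any solution of the equations valid among the labels is an evaluation. -/
theorem solves_eval {σ : Type} {n : ℕ} (L : Fin n → MvPolynomial σ ℕ)
    (hL : Good (Set.range L)) (h0 : 0 ∈ Set.range L) (x : Fin n → ℕ)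
    (hx : ∀ e : Eqn n, e.Holds L → e.Holds x) :
    ∃ v : σ → ℕ, ∀ i, x i = MvPolynomial.eval v (L i) := by
  obtain ⟨z, hz⟩ := h0
  have hadd : ∀ i j k, L i + L j = L k → x i + x j = x k := fun i j k h => hx (.add i j k) h
  have hmul : ∀ i j k, L i * L j = L k → x i * x j = x k := fun i j k h => hx (.mul i j k) h
  have hone : ∀ k, L k = 1 → x k = 1 := fun k h => hx (.one k) h
  have xz : x z = 0 := by
    have := hadd z z z (by rw [hz, add_zero])
    omega
  have hfib : ∀ i j, L i = L j → x i = x j := by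
    intro i j h
    have := hadd z i j (by rw [hz, zero_add, h])
    omega
  have : Nonempty (Fin n) := ⟨z⟩
  have hφ : ∀ i, x (Function.invFun L (L i)) = x i := fun i =>
    hfib _ _ (Function.invFun_eq ⟨i, rfl⟩)
  refine ⟨fun j => x (Function.invFun L (MvPolynomial.X j)), fun i => ?_⟩
  rw [← hφ i]
  refine hL (fun p => x (Function.invFun L p)) ⟨?_, ?_, ?_⟩ (L i) ⟨i, rfl⟩
  · rintro ⟨k, hk⟩
    rw [← hk]
    simp only [hφ]
    exact hone k hk
  · rintro _ _ ⟨i, rfl⟩ ⟨j, rfl⟩ ⟨k, hk⟩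
    rw [← hk]
    simp only [hφ]
    exact hadd i j k hk.symm
  · rintro _ _ ⟨i, rfl⟩ ⟨j, rfl⟩ ⟨k, hk⟩
    rw [← hk]
    simp only [hφ]
    exact hmul i j k hk.symm

theorem exists_label {α : Type*} (F : Set α) (hF : F.Finite) (hne : F.Nonempty) (n : ℕ)
    (hn : F.ncard ≤ n) : ∃ L : Fin n → α, Set.range L = F := by
  have : Fintype F := hF.fintype
  have : Nonempty F := hne.to_subtype
  have hc : Fintype.card F ≤ Fintype.card (Fin n) := by
    rw [Fintype.card_fin, ← Nat.card_eq_fintype_card]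
    exact hn
  obtain ⟨e⟩ := Function.Embedding.nonempty_of_card_le hc
  refine ⟨fun i => (Function.invFun e i : F), ?_⟩
  ext a
  constructor
  · rintro ⟨i, rfl⟩
    exact Subtype.prop _
  · intro ha
    exact ⟨e ⟨a, ha⟩, by simp [Function.leftInverse_invFun e.injective ⟨a, ha⟩]⟩

theorem stmt_9 (g : ℕ → ℕ) (hg : FiniteFoldRep g) :
    ∃ m : ℕ, 0 < m ∧ ∀ n : ℕ, m ≤ n → g n < fOmega n := by
  obtain ⟨m, W, hW, hfin⟩ := hg
  obtain ⟨P, Q, hPQ⟩ := exists_split W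
  have hcons : ∀ (a b : ℕ) (y : Fin m → ℕ),
      (Fin.cons (a : ℤ) (Fin.cons (b : ℤ) (fun i => (y i : ℤ))) : Fin (m + 2) → ℤ) =
      fun i => (((Fin.cons a (Fin.cons b y) : Fin (m + 2) → ℕ) i : ℕ) : ℤ) := by
    intro a b y
    funext i
    refine Fin.cases ?_ (fun i => ?_) i
    · simp
    · refine Fin.cases ?_ (fun i => ?_) i <;> simp
  have hzero : ∀ (a b : ℕ) (y : Fin m → ℕ),
      MvPolynomial.eval (Fin.cons (a : ℤ) (Fin.cons (b : ℤ) (fun i => (y i : ℤ)))) W = 0 ↔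
      MvPolynomial.eval (Fin.cons a (Fin.cons b y) : Fin (m + 2) → ℕ) P =
      MvPolynomial.eval (Fin.cons a (Fin.cons b y) : Fin (m + 2) → ℕ) Q := by
    intro a b y
    rw [hcons, hPQ]
    omega
  obtain ⟨F1, fF1, hP, gF1⟩ := exists_good P
  obtain ⟨F2, fF2, hQ, gF2⟩ := exists_good Q
  obtain ⟨F3, fF3, hB, gF3⟩ := exists_good (MvPolynomial.X 1 + 1 : MvPolynomial (Fin (m + 2)) ℕ)
  obtain ⟨F4, fF4, hA, gF4⟩ := exists_good (MvPolynomial.X 0 : MvPolynomial (Fin (m + 2)) ℕ)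
  set G := F1 ∪ F2 ∪ F3 ∪ F4 with hG
  have fG : G.Finite := ((fF1.union fF2).union fF3).union fF4
  have gG : Good G := ((gF1.union gF2).union gF3).union gF4
  refine ⟨2 * G.ncard + 20, by omega, fun n hn => ?_⟩
  set q := n / 2 with hq
  obtain ⟨F, fF, gF, hGF, h0, hnF, hcard⟩ : ∃ F : Set (MvPolynomial (Fin (m + 2)) ℕ),
      F.Finite ∧ Good F ∧ G ⊆ F ∧ 0 ∈ F ∧ (n : MvPolynomial (Fin (m + 2)) ℕ) ∈ F ∧
        F.ncard ≤ n := by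
    have key : (n : MvPolynomial (Fin (m + 2)) ℕ) =
        ((q : MvPolynomial (Fin (m + 2)) ℕ) + (q : MvPolynomial (Fin (m + 2)) ℕ)) +
          ((n % 2 : ℕ) : MvPolynomial (Fin (m + 2)) ℕ) := by
      rw [← Nat.cast_add, ← Nat.cast_add]
      congr 1
      omega
    refine ⟨insert (((q : MvPolynomial (Fin (m + 2)) ℕ) + (q : MvPolynomial (Fin (m + 2)) ℕ)) +
          ((n % 2 : ℕ) : MvPolynomial (Fin (m + 2)) ℕ))
        (insert ((q : MvPolynomial (Fin (m + 2)) ℕ) + (q : MvPolynomial (Fin (m + 2)) ℕ))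
          (G ∪ numerals _ q)), ?_, ?_, ?_, ?_, ?_, ?_⟩
    · exact ((fG.union (finite_numerals q)).insert _).insert _
    · exact ((gG.union (good_numerals q)).insert_add (.inr (mem_numerals (by omega)))
        (.inr (mem_numerals (by omega)))).insert_add (.inl rfl)
          (.inr (.inr (mem_numerals (by omega))))
    · exact fun p hp => .inr (.inr (.inl hp))
    · refine .inr (.inr (.inr ?_))
      have := mem_numerals (σ := Fin (m + 2)) (q := q) (j := 0) (by omega)
      simpa using this
    · exact .inl key
    · refine (Set.ncard_insert_le _ _).trans ?_
      have h1 := Set.ncard_insert_le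
        ((q : MvPolynomial (Fin (m + 2)) ℕ) + (q : MvPolynomial (Fin (m + 2)) ℕ))
          (G ∪ numerals _ q)
      have h2 := Set.ncard_union_le G (numerals (Fin (m + 2)) q)
      have h3 := ncard_numerals (σ := Fin (m + 2)) q
      omega
  obtain ⟨L, hL⟩ := exists_label F fF ⟨0, h0⟩ n hcard
  rw [← hL] at gF hGF h0 hnF
  obtain ⟨z, hz⟩ := h0
  obtain ⟨c, hc⟩ := hnF
  obtain ⟨iP, hiP⟩ := hGF (.inl (.inl (.inl hP)))
  obtain ⟨iQ, hiQ⟩ := hGF (.inl (.inl (.inr hQ)))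
  obtain ⟨iB, hiB⟩ := hGF (.inl (.inr hB))
  obtain ⟨iA, hiA⟩ := hGF (.inr hA)
  let S : Set (Eqn n) := {e | e.Holds L} ∪ {.add iA z c, .add iP z iQ}
  -- characterization of the solutions
  have hsol : ∀ x : Fin n → ℕ, Solves S x → ∃ y : Fin m → ℕ,
      MvPolynomial.eval (Fin.cons (n : ℤ) (Fin.cons (g n : ℤ) (fun i => (y i : ℤ)))) W = 0 ∧
      x = fun i => MvPolynomial.eval (Fin.cons n (Fin.cons (g n) y) : Fin (m + 2) → ℕ) (L i) := by
    intro x hx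
    obtain ⟨v, hv⟩ := solves_eval L gF ⟨z, hz⟩ x (fun e he => hx e (.inl he))
    have e1 : x iA + x z = x c := hx (.add iA z c) (.inr (.inl rfl))
    have e2 : x iP + x z = x iQ := hx (.add iP z iQ) (.inr (.inr rfl))
    simp only [hv, hiA, hz, hc, hiP, hiQ, MvPolynomial.eval_X, map_zero, add_zero,
      map_natCast, Nat.cast_id] at e1 e2
    have hvv : v = Fin.cons n (Fin.cons (v 1) (fun i : Fin m => v i.succ.succ)) := by
      funext i
      refine Fin.cases ?_ (fun i => ?_) i
      · simpa using e1
      · refine Fin.cases ?_ (fun i => ?_) i <;> simp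
    have hw : MvPolynomial.eval (Fin.cons (n : ℤ) (Fin.cons ((v 1 : ℕ) : ℤ)
        (fun i : Fin m => (v i.succ.succ : ℤ)))) W = 0 := by
      rw [hzero n (v 1) (fun i : Fin m => v i.succ.succ), ← hvv]
      exact e2
    have hgn : g n = v 1 := (hW n (v 1)).2 ⟨_, hw⟩
    refine ⟨fun i : Fin m => v i.succ.succ, by rw [hgn]; exact hw, ?_⟩
    funext i
    rw [hgn, ← hvv]
    exact hv i
  have hne : {x : Fin n → ℕ | Solves S x}.Nonempty := by
    obtain ⟨y, hy⟩ := (hW n (g n)).1 rfl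
    rw [hzero] at hy
    refine ⟨fun i => MvPolynomial.eval (Fin.cons n (Fin.cons (g n) y) : Fin (m + 2) → ℕ) (L i),
      ?_⟩
    rintro e (he | rfl | rfl)
    · exact holds_eval L _ e he
    · simp [Eqn.Holds, hiA, hz, hc]
    · simpa [Eqn.Holds, hiP, hz, hiQ] using hy
  have hfinS : {x : Fin n → ℕ | Solves S x}.Finite := by
    refine ((hfin n (g n)).image (fun y => fun i =>
      MvPolynomial.eval (Fin.cons n (Fin.cons (g n) y) : Fin (m + 2) → ℕ) (L i))).subset ?_
    intro x hx
    obtain ⟨y, hy, rfl⟩ := hsol x hx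
    exact ⟨y, hy, rfl⟩
  obtain ⟨x, hx, hxb⟩ := fOmega_spec n S hne hfinS
  obtain ⟨y, -, rfl⟩ := hsol x hx
  have hb := hxb iB
  have h1 : (Fin.cons n (Fin.cons (g n) y) : Fin (m + 2) → ℕ) 1 = g n := rfl
  simp only [hiB, map_add, map_one, MvPolynomial.eval_X, h1] at hb
  omega
end

section
/- If a function g : ℕ → ℕ has a Diophantine representation, then there exists a positive integer m such that g(n) < f_{ω₁}(n) for every integer n ≥ m. -/
/-- `fOmega1 n` is the smallest `b` such that for each system `S ⊆ E_n` which has a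
solution in non-negative integers, some solution has all coordinates `≤ b`. -/
noncomputable def fOmega1 (n : ℕ) : ℕ :=
  sInf {b : ℕ | ∀ S : Set (Eqn n),
    (∃ x : Fin n → ℕ, Solves S x) →
    ∃ x : Fin n → ℕ, Solves S x ∧ ∀ i, x i ≤ b}

/-- `g : ℕ → ℕ` has a Diophantine representation. -/
def DiophRep (g : ℕ → ℕ) : Prop :=
  ∃ (m : ℕ) (W : MvPolynomial (Fin (m + 2)) ℤ),
    ∀ a b : ℕ, g a = b ↔ ∃ x : Fin m → ℕ,
      MvPolynomial.eval (Fin.cons (a : ℤ) (Fin.cons (b : ℤ) (fun i => (x i : ℤ)))) W = 0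

/-- A partial homomorphism defined on a finite set `B` of natural numbers. -/
structure PHom (B : Finset ℕ) (φ : ℕ → ℕ) : Prop where
  one : 1 ∈ B → φ 1 = 1
  add : ∀ a b, a ∈ B → b ∈ B → a + b ∈ B → φ (a + b) = φ a + φ b
  mul : ∀ a b, a ∈ B → b ∈ B → a * b ∈ B → φ (a * b) = φ a * φ b

lemma PHom.range {B : Finset ℕ} {φ : ℕ → ℕ} (h : PHom B φ) (k : ℕ) (h1 : 1 ∈ B)
    (hk : ∀ j ≤ k, j ∈ B) : ∀ j ≤ k, φ j = j := by
  intro j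
  induction j with
  | zero =>
    intro _
    have h0 := hk 0 (Nat.zero_le _)
    have := h.add 0 0 h0 h0 h0
    simp at this
    exact this
  | succ j ih =>
    intro hj
    rw [h.add j 1 (hk j (by omega)) h1 (hk _ hj), ih (by omega), h.one h1]

lemma poly_encode {σ : Type*} (p : MvPolynomial σ ℤ) :
    ∃ C : ℕ, ∀ v : σ → ℕ, ∃ A : Finset ℕ, A.card ≤ C ∧ ∃ u ∈ A, ∃ w ∈ A,
      MvPolynomial.eval (fun i => (v i : ℤ)) p = (u : ℤ) - w ∧
      ∀ B : Finset ℕ, ∀ φ : ℕ → ℕ, A ⊆ B → (∀ i, v i ∈ B) → 1 ∈ B → PHom B φ →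
        MvPolynomial.eval (fun i => (φ (v i) : ℤ)) p = (φ u : ℤ) - φ w := by
  induction p using MvPolynomial.induction_on with
  | C a =>
    refine ⟨a.natAbs + 1, fun v => ⟨Finset.range (a.natAbs + 1), by simp,
      a.toNat, Finset.mem_range.2 (by omega), (-a).toNat, Finset.mem_range.2 (by omega),
      by rw [MvPolynomial.eval_C]; omega, ?_⟩⟩
    intro B φ hA _ h1 hφ
    have := hφ.range a.natAbs h1 (fun j hj => hA (Finset.mem_range.2 (by omega)))
    rw [this _ (by omega), this _ (by omega)]
    rw [MvPolynomial.eval_C]; omega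
  | add p q hp hq =>
    obtain ⟨C1, h1⟩ := hp
    obtain ⟨C2, h2⟩ := hq
    refine ⟨(C1 + C2) + 1 + 1, fun v => ?_⟩
    obtain ⟨A1, c1, u1, hu1, w1, hw1, e1, H1⟩ := h1 v
    obtain ⟨A2, c2, u2, hu2, w2, hw2, e2, H2⟩ := h2 v
    refine ⟨insert (u1 + u2) (insert (w1 + w2) (A1 ∪ A2)), ?_, u1 + u2, by simp,
      w1 + w2, by simp, by simp [e1, e2]; ring, ?_⟩
    · have := Finset.card_union_le A1 A2
      have := Finset.card_insert_le (w1 + w2) (A1 ∪ A2)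
      have := Finset.card_insert_le (u1 + u2) (insert (w1 + w2) (A1 ∪ A2))
      omega
    · intro B φ hA hv h1 hφ
      have hA1 : A1 ⊆ B := fun x hx => hA (by simp [hx])
      have hA2 : A2 ⊆ B := fun x hx => hA (by simp [hx])
      rw [hφ.add _ _ (hA1 hu1) (hA2 hu2) (hA (by simp)),
        hφ.add _ _ (hA1 hw1) (hA2 hw2) (hA (by simp))]
      rw [map_add, H1 B φ hA1 hv h1 hφ, H2 B φ hA2 hv h1 hφ]
      push_cast; ring
  | mul_X p i hp =>
    obtain ⟨C1, h1⟩ := hp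
    refine ⟨C1 + 1 + 1, fun v => ?_⟩
    obtain ⟨A1, c1, u1, hu1, w1, hw1, e1, H1⟩ := h1 v
    refine ⟨insert (u1 * v i) (insert (w1 * v i) A1), ?_, u1 * v i, by simp,
      w1 * v i, by simp, by simp [e1]; ring, ?_⟩
    · have := Finset.card_insert_le (w1 * v i) A1
      have := Finset.card_insert_le (u1 * v i) (insert (w1 * v i) A1)
      omega
    · intro B φ hA hv h1 hφ
      have hA1 : A1 ⊆ B := fun x hx => hA (by simp [hx])
      rw [hφ.mul _ _ (hA1 hu1) (hv i) (hA (by simp)),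
        hφ.mul _ _ (hA1 hw1) (hv i) (hA (by simp))]
      rw [map_mul, H1 B φ hA1 hv h1 hφ, MvPolynomial.eval_X]
      push_cast; ring

instance eqn_finite_s10 (n : ℕ) : Finite (Eqn n) := by
  let f : Eqn n → Fin n ⊕ ((Fin n × Fin n × Fin n) ⊕ (Fin n × Fin n × Fin n)) := fun e =>
    match e with
    | .one k => .inl k
    | .add i j k => .inr (.inl (i, j, k))
    | .mul i j k => .inr (.inr (i, j, k))
  apply Finite.of_injective f
  intro a b h
  cases a <;> cases b <;> simp_all [f]

lemma fOmega1_spec (n : ℕ) (S : Set (Eqn n)) (hS : ∃ x : Fin n → ℕ, Solves S x) :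
    ∃ x : Fin n → ℕ, Solves S x ∧ ∀ i, x i ≤ fOmega1 n := by
  have hne : {b : ℕ | ∀ S : Set (Eqn n), (∃ x : Fin n → ℕ, Solves S x) →
      ∃ x : Fin n → ℕ, Solves S x ∧ ∀ i, x i ≤ b}.Nonempty := by
    have key : ∀ S : Set (Eqn n), ∃ b : ℕ, (∃ x : Fin n → ℕ, Solves S x) →
        ∃ x : Fin n → ℕ, Solves S x ∧ ∀ i, x i ≤ b := by
      intro S
      by_cases h : ∃ x : Fin n → ℕ, Solves S x
      · obtain ⟨x, hx⟩ := h
        exact ⟨∑ i, x i, fun _ => ⟨x, hx, fun i =>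
          Finset.single_le_sum (f := x) (fun _ _ => Nat.zero_le _) (Finset.mem_univ i)⟩⟩
      · exact ⟨0, fun h' => absurd h' h⟩
    choose b hb using key
    obtain ⟨M, hM⟩ := (Set.finite_range b).bddAbove
    refine ⟨M, fun S hS => ?_⟩
    obtain ⟨x, hx, hle⟩ := hb S hS
    exact ⟨x, hx, fun i => (hle i).trans (hM ⟨S, rfl⟩)⟩
  exact Nat.sInf_mem hne S hS

lemma exists_phom (n : ℕ) (B : Finset ℕ) (hB : B.card ≤ n) :
    ∃ φ : ℕ → ℕ, PHom B φ ∧ ∀ a ∈ B, φ a ≤ fOmega1 n := by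
  classical
  let x0 : Fin n → ℕ := fun i => B.toList.getD i 0
  have hx0 : ∀ a ∈ B, ∃ i, x0 i = a := by
    intro a ha
    obtain ⟨i, hi, h⟩ := List.getElem_of_mem (Finset.mem_toList.2 ha)
    refine ⟨⟨i, by rw [Finset.length_toList] at hi; omega⟩, ?_⟩
    show B.toList.getD i 0 = a
    rw [List.getD_eq_getElem _ _ hi, h]
  obtain ⟨x, hx, hle⟩ := fOmega1_spec n {e | e.Holds x0} ⟨x0, fun e he => he⟩
  choose idx hidx using hx0
  by_cases hn : B.Nonempty
  swap
  · rw [Finset.not_nonempty_iff_eq_empty] at hn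
    subst hn
    exact ⟨id, ⟨by simp, by simp, by simp⟩, by simp⟩
  have : ∀ a, ∃ y, ∀ h : a ∈ B, ∃ i, x0 i = a ∧ x i = y := by
    intro a
    by_cases h : a ∈ B
    · exact ⟨x (idx a h), fun _ => ⟨_, hidx a h, rfl⟩⟩
    · exact ⟨0, fun h' => absurd h' h⟩
  choose φ hφ using this
  refine ⟨φ, ⟨?_, ?_, ?_⟩, ?_⟩
  · intro h
    obtain ⟨i, hi, e⟩ := hφ 1 h
    rw [← e]
    exact hx (.one i) hi
  · intro a b ha hb hab
    obtain ⟨i, hi, ei⟩ := hφ a ha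
    obtain ⟨j, hj, ej⟩ := hφ b hb
    obtain ⟨k, hk, ek⟩ := hφ _ hab
    rw [← ei, ← ej, ← ek]
    exact (hx (.add i j k) (show x0 i + x0 j = x0 k by rw [hi, hj, hk])).symm
  · intro a b ha hb hab
    obtain ⟨i, hi, ei⟩ := hφ a ha
    obtain ⟨j, hj, ej⟩ := hφ b hb
    obtain ⟨k, hk, ek⟩ := hφ _ hab
    rw [← ei, ← ej, ← ek]
    exact (hx (.mul i j k) (show x0 i * x0 j = x0 k by rw [hi, hj, hk])).symm
  · intro a ha
    obtain ⟨i, _, e⟩ := hφ a ha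
    rw [← e]
    exact hle i

theorem stmt_10 (g : ℕ → ℕ) (hg : DiophRep g) :
    ∃ m : ℕ, 0 < m ∧ ∀ n : ℕ, m ≤ n → g n < fOmega1 n := by
  classical
  obtain ⟨m, W, hW⟩ := hg
  obtain ⟨C, hC⟩ := poly_encode W
  refine ⟨2 * (C + m + 20), by omega, fun n hn => ?_⟩
  obtain ⟨x, hx⟩ := (hW n (g n)).1 rfl
  let v : Fin (m + 2) → ℕ := Fin.cons n (Fin.cons (g n) x)
  have hv : ∀ ψ : ℕ → ℕ, (fun i => (ψ (v i) : ℤ)) =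
      Fin.cons (ψ n : ℤ) (Fin.cons (ψ (g n) : ℤ) (fun i => (ψ (x i) : ℤ))) := by
    intro ψ
    funext i
    refine Fin.cases rfl (fun i => ?_) i
    exact Fin.cases rfl (fun i => rfl) i
  obtain ⟨A, hA, u, hu, w, hw, e, H⟩ := hC v
  have hv0 := hv id
  simp only [id] at hv0
  rw [hv0, hx] at e
  have huw : u = w := by omega
  let k := n / 2
  let B : Finset ℕ := ((A ∪ Finset.univ.image v) ∪ Finset.range (k + 1)) ∪ {k + k, g n + 1}
  have hcard : B.card ≤ n := by
    have h1 := Finset.card_union_le ((A ∪ Finset.univ.image v) ∪ Finset.range (k + 1))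
      {k + k, g n + 1}
    have h2 := Finset.card_union_le (A ∪ Finset.univ.image v) (Finset.range (k + 1))
    have h3 := Finset.card_union_le A (Finset.univ.image v)
    have h4 : (Finset.univ.image v).card ≤ m + 2 := by
      simpa using Finset.card_image_le (s := Finset.univ) (f := v)
    have h5 : ({k + k, g n + 1} : Finset ℕ).card ≤ 2 := Finset.card_le_two
    rw [Finset.card_range] at h2
    have : k = n / 2 := rfl
    refine h1.trans ?_
    omega
  have hvB : ∀ i, v i ∈ B := fun i => by simp [B]
  have hrB : ∀ j ≤ k, j ∈ B := fun j hj => by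
    simp only [B, Finset.mem_union, Finset.mem_range]; left; right; omega
  have hAB : A ⊆ B := fun a ha => by simp [B, ha]
  have hk1 : 1 ≤ k := by show 1 ≤ n / 2; omega
  have h1B := hrB 1 hk1
  have hnB : n ∈ B := hvB 0
  have hgB : g n ∈ B := hvB 1
  obtain ⟨φ, hφ, hle⟩ := exists_phom n B hcard
  have hr := hφ.range k h1B hrB
  have hkk : φ (k + k) = k + k := by
    rw [hφ.add k k (hrB k le_rfl) (hrB k le_rfl) (by simp [B]), hr k le_rfl]
  have hφn : φ n = n := by
    rcases Nat.even_or_odd' n with ⟨c, hc | hc⟩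
    · have : n = k + k := by show n = n / 2 + n / 2; omega
      rw [this]; exact hkk
    · have h : n = k + k + 1 := by show n = n / 2 + n / 2 + 1; omega
      have h' := hφ.add (k + k) 1 (by simp [B]) h1B (h ▸ hnB)
      rw [← h, hkk, hφ.one h1B] at h'
      omega
  have hz := H B φ hAB hvB h1B hφ
  rw [hv φ, huw, sub_self, hφn] at hz
  have hgφ : g n = φ (g n) := (hW n (φ (g n))).2 ⟨fun i => φ (x i), hz⟩
  have hgB1 : g n + 1 ∈ B := by simp [B]
  have h2 := hle _ hgB1
  rw [hφ.add _ _ hgB h1B hgB1, ← hgφ, hφ.one h1B] at h2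
  omega
end

section
/- If a function g : ℕ → ℕ has a single-fold Diophantine representation, then g(n) < h₂(n) for every sufficiently large positive integer n. -/
/-- `h₂ n` is the smallest `b` such that for each polynomial
`D(x, x_1, ..., x_i) ∈ B₂(n)` (total degree `≤ n`, coefficients in `[-n, n]`, `i ≤ n`,
and for each non-negative integer `j` the equation `D(j, x_1, ..., x_i) = 0` has
exactly one solution in non-negative integers), the equation `D(n, x_1, ..., x_i) = 0`
has a solution in non-negative integers all not greater than `b`. -/
noncomputable def h2 (n : ℕ) : ℕ :=
  sInf {b : ℕ | ∀ i : ℕ, i ≤ n → ∀ D : MvPolynomial (Fin (i + 1)) ℤ,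
    D.totalDegree ≤ n →
    (∀ m : Fin (i + 1) →₀ ℕ, |MvPolynomial.coeff m D| ≤ (n : ℤ)) →
    (∀ j : ℕ, ∃! x : Fin i → ℕ,
      MvPolynomial.eval (Fin.cons (j : ℤ) (fun t => (x t : ℤ))) D = 0) →
    ∃ x : Fin i → ℕ,
      MvPolynomial.eval (Fin.cons (n : ℤ) (fun t => (x t : ℤ))) D = 0 ∧ ∀ t, x t ≤ b}

theorem bounded_polys_finite (i n : ℕ) :
    {D : MvPolynomial (Fin (i + 1)) ℤ | D.totalDegree ≤ n ∧
      ∀ m : Fin (i + 1) →₀ ℕ, |MvPolynomial.coeff m D| ≤ (n : ℤ)}.Finite := by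
  classical
  let c : Fin (i + 1) →₀ ℕ := Finsupp.equivFunOnFinite.symm (fun _ => n)
  have hfin : Finite (Set.Iic c) := (Set.finite_Iic c).to_subtype
  let F : {D : MvPolynomial (Fin (i + 1)) ℤ | D.totalDegree ≤ n ∧
      ∀ m : Fin (i + 1) →₀ ℕ, |MvPolynomial.coeff m D| ≤ (n : ℤ)} →
      (Set.Iic c → Set.Icc (-(n : ℤ)) n) :=
    fun D m => ⟨MvPolynomial.coeff m.1 D.1, abs_le.mp (D.2.2 m.1)⟩
  have hF : Function.Injective F := by
    rintro ⟨D, hD, hD'⟩ ⟨E, hE, hE'⟩ h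
    apply Subtype.ext
    have key : ∀ P : MvPolynomial (Fin (i + 1)) ℤ, P.totalDegree ≤ n →
        ∀ m, ¬ m ≤ c → MvPolynomial.coeff m P = 0 := by
      intro P hP m hm
      by_contra h0
      apply hm
      intro t
      have h1 := MvPolynomial.le_totalDegree (MvPolynomial.mem_support_iff.mpr h0)
      have h2 : m t ≤ m.sum fun _ e => e := by
        rw [Finsupp.sum_fintype _ _ (fun _ => rfl)]
        exact Finset.single_le_sum (f := fun t => m t) (fun _ _ => Nat.zero_le _)
          (Finset.mem_univ t)
      exact h2.trans (h1.trans hP)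
    apply MvPolynomial.ext
    intro m
    by_cases hm : m ≤ c
    · exact congrArg Subtype.val (congrFun h ⟨m, hm⟩)
    · rw [key D hD m hm, key E hE m hm]
  have : Finite _ := Finite.of_injective F hF
  exact Set.toFinite _

theorem h2_mem (n : ℕ) : ∀ i : ℕ, i ≤ n → ∀ D : MvPolynomial (Fin (i + 1)) ℤ,
    D.totalDegree ≤ n →
    (∀ m : Fin (i + 1) →₀ ℕ, |MvPolynomial.coeff m D| ≤ (n : ℤ)) →
    (∀ j : ℕ, ∃! x : Fin i → ℕ,
      MvPolynomial.eval (Fin.cons (j : ℤ) (fun t => (x t : ℤ))) D = 0) →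
    ∃ x : Fin i → ℕ,
      MvPolynomial.eval (Fin.cons (n : ℤ) (fun t => (x t : ℤ))) D = 0 ∧ ∀ t, x t ≤ h2 n := by
  apply Nat.sInf_mem (s := {b : ℕ | ∀ i : ℕ, i ≤ n → ∀ D : MvPolynomial (Fin (i + 1)) ℤ,
    D.totalDegree ≤ n →
    (∀ m : Fin (i + 1) →₀ ℕ, |MvPolynomial.coeff m D| ≤ (n : ℤ)) →
    (∀ j : ℕ, ∃! x : Fin i → ℕ,
      MvPolynomial.eval (Fin.cons (j : ℤ) (fun t => (x t : ℤ))) D = 0) →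
    ∃ x : Fin i → ℕ,
      MvPolynomial.eval (Fin.cons (n : ℤ) (fun t => (x t : ℤ))) D = 0 ∧ ∀ t, x t ≤ b})
  have key : ∀ᶠ b : ℕ in Filter.atTop, ∀ i ∈ Set.Iic n,
      ∀ D ∈ {D : MvPolynomial (Fin (i + 1)) ℤ | D.totalDegree ≤ n ∧
        ∀ m : Fin (i + 1) →₀ ℕ, |MvPolynomial.coeff m D| ≤ (n : ℤ)},
      (∀ j : ℕ, ∃! x : Fin i → ℕ,
        MvPolynomial.eval (Fin.cons (j : ℤ) (fun t => (x t : ℤ))) D = 0) →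
      ∃ x : Fin i → ℕ,
        MvPolynomial.eval (Fin.cons (n : ℤ) (fun t => (x t : ℤ))) D = 0 ∧ ∀ t, x t ≤ b := by
    rw [Filter.eventually_all_finite (Set.finite_Iic n)]
    intro i _
    rw [Filter.eventually_all_finite (bounded_polys_finite i n)]
    intro D _
    by_cases h : ∀ j : ℕ, ∃! x : Fin i → ℕ,
        MvPolynomial.eval (Fin.cons (j : ℤ) (fun t => (x t : ℤ))) D = 0
    · obtain ⟨x, hx, -⟩ := h n
      filter_upwards [Filter.eventually_ge_atTop (∑ t, x t)] with b hb _
      exact ⟨x, hx, fun t => (Finset.single_le_sum (f := x) (fun _ _ => Nat.zero_le _)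
          (Finset.mem_univ t)).trans hb⟩
    · exact Filter.Eventually.of_forall fun b h' => absurd h' h
  obtain ⟨b, hb⟩ := key.exists
  exact ⟨b, fun i hi D h1 h3 h4 => hb i hi D ⟨h1, h3⟩ h4⟩

theorem stmt_11 (g : ℕ → ℕ) (hg : SingleFoldRep g) :
    ∃ N : ℕ, 0 < N ∧ ∀ n : ℕ, N ≤ n → g n < h2 n := by
  obtain ⟨m, W, hW, hu⟩ := hg
  let f : Fin (m + 2) → Fin (m + 2 + 1) := Fin.cons 0 (fun j => j.succ.succ)
  let D : MvPolynomial (Fin (m + 2 + 1)) ℤ :=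
    MvPolynomial.rename f W ^ 2 +
      (MvPolynomial.X 1 - MvPolynomial.X (Fin.succ (Fin.succ 0)) - 1) ^ 2
  have hf : ∀ (a : ℤ) (v : Fin (m + 2) → ℤ),
      (Fin.cons a v : Fin (m + 2 + 1) → ℤ) ∘ f = Fin.cons a (fun j => v j.succ) := by
    intro a v
    funext j
    refine Fin.cases ?_ (fun j => ?_) j <;> simp [f]
  have hD : ∀ (a : ℕ) (z : Fin (m + 2) → ℕ),
      MvPolynomial.eval (Fin.cons (a : ℤ) (fun t => (z t : ℤ))) D = 0 ↔
      (MvPolynomial.eval (Fin.cons (a : ℤ) (Fin.cons ((z (Fin.succ 0) : ℕ) : ℤ)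
        (fun i : Fin m => (z i.succ.succ : ℤ)))) W = 0 ∧ z 0 = z (Fin.succ 0) + 1) := by
    intro a z
    have e1 : (fun j : Fin (m + 1) => (z j.succ : ℤ)) =
        Fin.cons ((z (Fin.succ 0) : ℕ) : ℤ) (fun i : Fin m => (z i.succ.succ : ℤ)) := by
      funext j
      refine Fin.cases ?_ (fun j => ?_) j <;> simp
    have e2 : (1 : Fin (m + 2 + 1)) = Fin.succ 0 := rfl
    simp only [D, map_add, map_pow, map_sub, MvPolynomial.eval_rename, MvPolynomial.eval_X,
      map_one, hf, e1, e2, Fin.cons_succ]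
    constructor
    · intro h
      rw [add_eq_zero_iff_of_nonneg (sq_nonneg _) (sq_nonneg _), sq_eq_zero_iff,
        sq_eq_zero_iff] at h
      exact ⟨h.1, by have := h.2; omega⟩
    · rintro ⟨h1, h3⟩
      rw [h1, h3]
      push_cast
      ring
  have hex : ∀ j : ℕ, ∃! x : Fin (m + 2) → ℕ,
      MvPolynomial.eval (Fin.cons (j : ℤ) (fun t => (x t : ℤ))) D = 0 := by
    intro j
    obtain ⟨x, hx⟩ := (hW j (g j)).mp rfl
    refine ⟨Fin.cons (g j + 1) (Fin.cons (g j) x), ?_, ?_⟩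
    · refine (hD _ _).mpr ⟨?_, ?_⟩
      · simpa using hx
      · simp
    · intro z hz
      obtain ⟨h1, h3⟩ := (hD _ _).mp hz
      have hg : g j = z (Fin.succ 0) := (hW j _).mpr ⟨fun i => z i.succ.succ, h1⟩
      rw [← hg] at h1 h3
      have hx' := hu _ _ _ _ h1 hx
      funext t
      refine Fin.cases ?_ (fun t => ?_) t
      · simpa using h3
      · refine Fin.cases ?_ (fun t => ?_) t
        · simpa using hg.symm
        · simpa using congrFun hx' t
  refine ⟨m + 2 + D.totalDegree + ∑ s ∈ D.support, (MvPolynomial.coeff s D).natAbs,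
    by omega, fun n hn => ?_⟩
  obtain ⟨z, hz, hb⟩ := h2_mem n (m + 2) (by omega) D (by omega) (by
    intro s
    by_cases hs : s ∈ D.support
    · have := Finset.single_le_sum (f := fun s => (MvPolynomial.coeff s D).natAbs)
        (fun _ _ => Nat.zero_le _) hs
      rw [Int.abs_eq_natAbs]; omega
    · rw [MvPolynomial.notMem_support_iff.mp hs]; simp) hex
  obtain ⟨h1, h3⟩ := (hD _ _).mp hz
  have hg : g n = z (Fin.succ 0) := (hW n _).mpr ⟨fun i => z i.succ.succ, h1⟩
  have := hb 0
  omega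
end
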